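/- Main theorem: for the broadcast process on the infinite rooted d-regular tree with q ≥ 3 communities, there exists a constant C*(q) depending only on q such that if λ²d > C*(q), then lim_{m→∞} |E_m − Ẽ_m| = 0; that is, the optimal probability of reconstructing the root label from the exact labels at depth m and from the noisy labels at depth m converge to the same limit. -/

import Mathlib

open MeasureTheory ProbabilityTheory Filter

/-- Transition matrix of the broadcast process. -/
noncomputable def transM (q : ℕ) (p : ℝ) (a b : Fin q) : ℝ :=
  if a = b then 1 - p else p / ((q : ℝ) - 1)

/-- The σ-algebra generated by the depth-`m` labels of the process `leaves`. -/
noncomputable def leafAlg {Ω : Type} [MeasurableSpace Ω] {q d : ℕ}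
    (leaves : List (Fin d) → Ω → Fin q) (m : ℕ) : MeasurableSpace Ω :=
  MeasurableSpace.comap (fun ω => fun f : Fin m → Fin d => leaves (List.ofFn f) ω)
    inferInstance

/-- Posterior probability that the root label equals `i`, given the depth-`m` labels. -/
noncomputable def posterior {Ω : Type} [MeasurableSpace Ω] {q d : ℕ} (μ : Measure Ω)
    (root : Ω → Fin q) (leaves : List (Fin d) → Ω → Fin q) (i : Fin q) (m : ℕ) : Ω → ℝ :=
  μ[Set.indicator {ω | root ω = i} (fun _ => (1 : ℝ)) | leafAlg leaves m]

/-- Optimal probability of reconstructing the root from depth-`m` labels. -/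
noncomputable def optRecon {Ω : Type} [MeasurableSpace Ω] {q d : ℕ} (μ : Measure Ω)
    (root : Ω → Fin q) (leaves : List (Fin d) → Ω → Fin q) (m : ℕ) : ℝ :=
  ∫ ω, ⨆ i : Fin q, posterior μ root leaves i m ω ∂μ


section Analysis

variable {q : ℕ}

/-- The action of the transition matrix on a vector indexed by the labels. -/
noncomputable def mixVec (p : ℝ) (z : Fin q → ℝ) (i : Fin q) : ℝ :=
  ∑ s, transM q p i s * z s

/-- The Bregman-type divergence of the concave function `z ↦ √(z i * z j)`. -/
noncomputable def affDiv (z w : Fin q → ℝ) (i j : Fin q) : ℝ :=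
  (√(z i * w j) - √(z j * w i)) ^ 2 / √(w i * w j)

lemma affDiv_nonneg (z w : Fin q → ℝ) (i j : Fin q) : 0 ≤ affDiv z w i j := by
  unfold affDiv; positivity

lemma transM_self (p : ℝ) (i : Fin q) : transM q p i i = 1 - p := by simp [transM]

lemma transM_of_ne (p : ℝ) {i j : Fin q} (h : i ≠ j) : transM q p i j = p / ((q : ℝ) - 1) := by
  simp [transM, h]

lemma transM_pos (hq : 3 ≤ q) {p : ℝ} (hp0 : 0 < p) (hp1 : p < 1) (i j : Fin q) :
    0 < transM q p i j := by
  have : (3 : ℝ) ≤ q := by exact_mod_cast hq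
  unfold transM
  split_ifs
  · linarith
  · apply div_pos hp0; linarith

lemma mixVec_eq (p : ℝ) (z : Fin q → ℝ) (i : Fin q) :
    mixVec p z i = (1 - p - p / ((q : ℝ) - 1)) * z i + p / ((q : ℝ) - 1) * ∑ s, z s := by
  have h : ∀ s, transM q p i s * z s
      = (if i = s then (1 - p - p / ((q : ℝ) - 1)) * z s else 0) + p / ((q : ℝ) - 1) * z s := by
    intro s
    unfold transM
    split_ifs <;> ring
  unfold mixVec
  rw [Finset.sum_congr rfl fun s _ => h s, Finset.sum_add_distrib, ← Finset.mul_sum]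
  simp

lemma lam_eq (hq : 3 ≤ q) (p : ℝ) :
    1 - p * q / ((q : ℝ) - 1) = 1 - p - p / ((q : ℝ) - 1) := by
  have : (3 : ℝ) ≤ q := by exact_mod_cast hq
  have h : (q : ℝ) - 1 ≠ 0 := by linarith
  field_simp
  ring

lemma mixVec_nonneg (hq : 3 ≤ q) {p : ℝ} (hp0 : 0 < p) (hp1 : p < 1) {z : Fin q → ℝ}
    (hz : ∀ i, 0 ≤ z i) (i : Fin q) : 0 ≤ mixVec p z i :=
  Finset.sum_nonneg fun s _ => mul_nonneg (transM_pos hq hp0 hp1 i s).le (hz s)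

lemma mixVec_pos (hq : 3 ≤ q) {p : ℝ} (hp0 : 0 < p) (hp1 : p < 1) {z : Fin q → ℝ}
    (hz : ∀ i, 0 ≤ z i) (hz' : ∃ i, 0 < z i) (i : Fin q) : 0 < mixVec p z i := by
  obtain ⟨s, hs⟩ := hz'
  exact Finset.sum_pos' (fun s _ => mul_nonneg (transM_pos hq hp0 hp1 i s).le (hz s))
    ⟨s, Finset.mem_univ _, mul_pos (transM_pos hq hp0 hp1 i s) hs⟩

lemma pair_le_mixVec (hq : 3 ≤ q) {p : ℝ} (hp0 : 0 < p) (hp1 : p < 1) {z : Fin q → ℝ}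
    (hz : ∀ i, 0 ≤ z i) (i : Fin q) {k l : Fin q} (hkl : k ≠ l) :
    transM q p i k * z k + transM q p i l * z l ≤ mixVec p z i := by
  rw [← Finset.sum_pair hkl (f := fun s => transM q p i s * z s)]
  exact Finset.sum_le_sum_of_subset_of_nonneg (Finset.subset_univ _)
    fun s _ _ => mul_nonneg (transM_pos hq hp0 hp1 i s).le (hz s)

/-- The two cross products of mixed vectors dominate those of the original vectors along the
pair of labels being compared. -/
lemma mixVec_cross_self (hq : 3 ≤ q) {p : ℝ} (hp0 : 0 < p) (hp1 : p < 1) {z w : Fin q → ℝ}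
    (hz : ∀ i, 0 ≤ z i) (hw : ∀ i, 0 ≤ w i) {i j : Fin q} (hij : i ≠ j) :
    (1 - p + p / ((q : ℝ) - 1)) / (2 * q) * (z i * w j + z j * w i)
      ≤ mixVec p z i * mixVec p w j + mixVec p z j * mixVec p w i := by
  have hq' : (3 : ℝ) ≤ q := by exact_mod_cast hq
  have h1 := pair_le_mixVec hq hp0 hp1 hz i hij
  have h2 := pair_le_mixVec hq hp0 hp1 hw j hij
  have h3 := pair_le_mixVec hq hp0 hp1 hz j hij
  have h4 := pair_le_mixVec hq hp0 hp1 hw i hij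
  rw [transM_self, transM_of_ne p hij] at h1 h4
  rw [transM_self, transM_of_ne p hij.symm] at h2 h3
  set κ := p / ((q : ℝ) - 1) with hκ
  have hκ0 : 0 < κ := by apply div_pos hp0; linarith
  have hκp : p = κ * ((q : ℝ) - 1) := by rw [hκ]; field_simp [show (q : ℝ) - 1 ≠ 0 by linarith]
  have hμ : 1 / (q : ℝ) ≤ 1 - p + κ := by
    rw [div_le_iff₀ (by linarith)]
    nlinarith
  have ha : 0 < 1 - p := by linarith
  have hzi := hz i
  have hzj := hz j
  have hwi := hw i
  have hwj := hw j
  have hA : ((1 - p) * z i + κ * z j) * (κ * w i + (1 - p) * w j)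
      ≤ mixVec p z i * mixVec p w j :=
    mul_le_mul h1 h2 (by positivity) (by exact le_trans (by positivity) h1)
  have hB : (κ * z i + (1 - p) * z j) * ((1 - p) * w i + κ * w j)
      ≤ mixVec p z j * mixVec p w i :=
    mul_le_mul h3 h4 (by positivity) (by exact le_trans (by positivity) h3)
  refine le_trans ?_ (add_le_add hA hB)
  have hS : 0 ≤ z i * w j + z j * w i := by positivity
  have hc : (1 - p + κ) / (2 * q) ≤ (1 - p) ^ 2 + κ ^ 2 := by
    have e1 : (1 - p + κ) / (2 * q) = (1 - p + κ) * (1 / q) / 2 := by field_simp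
    rw [e1]
    nlinarith [sq_nonneg (1 - p - κ)]
  have : 0 ≤ (1 - p) * κ * (z i * w i) + (1 - p) * κ * (z j * w j) := by positivity
  nlinarith [mul_le_mul_of_nonneg_right hc hS]

lemma mixVec_cross_ne (hq : 3 ≤ q) {p : ℝ} (hp0 : 0 < p) (hp1 : p < 1) {z w : Fin q → ℝ}
    (hz : ∀ i, 0 ≤ z i) (hw : ∀ i, 0 ≤ w i) {i j l : Fin q} (hij : i ≠ j) (hil : i ≠ l)
    (hjl : j ≠ l) :
    (p / ((q : ℝ) - 1)) / (2 * q) * (z i * w l + z l * w i)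
      ≤ mixVec p z i * mixVec p w j + mixVec p z j * mixVec p w i := by
  have hq' : (3 : ℝ) ≤ q := by exact_mod_cast hq
  have h1 := pair_le_mixVec hq hp0 hp1 hz i hil
  have h2 := pair_le_mixVec hq hp0 hp1 hw j hil
  have h3 := pair_le_mixVec hq hp0 hp1 hz j hil
  have h4 := pair_le_mixVec hq hp0 hp1 hw i hil
  rw [transM_self, transM_of_ne p hil] at h1 h4
  rw [transM_of_ne p hjl, transM_of_ne p hij.symm] at h2 h3
  set κ := p / ((q : ℝ) - 1) with hκ
  have hκ0 : 0 < κ := by apply div_pos hp0; linarith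
  have hκp : p = κ * ((q : ℝ) - 1) := by rw [hκ]; field_simp [show (q : ℝ) - 1 ≠ 0 by linarith]
  have hμ : 1 / (q : ℝ) ≤ 1 - p + κ := by
    rw [div_le_iff₀ (by linarith)]
    nlinarith
  have ha : 0 < 1 - p := by linarith
  have hzi := hz i
  have hzl := hz l
  have hwi := hw i
  have hwl := hw l
  have hA : ((1 - p) * z i + κ * z l) * (κ * w i + κ * w l)
      ≤ mixVec p z i * mixVec p w j :=
    mul_le_mul h1 h2 (by positivity) (by exact le_trans (by positivity) h1)
  have hB : (κ * z i + κ * z l) * ((1 - p) * w i + κ * w l)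
      ≤ mixVec p z j * mixVec p w i :=
    mul_le_mul h3 h4 (by positivity) (by exact le_trans (by positivity) h3)
  refine le_trans ?_ (add_le_add hA hB)
  have hS : 0 ≤ z i * w l + z l * w i := by positivity
  have hc : κ / (2 * q) ≤ κ * (1 - p + κ) := by
    have e1 : κ / (2 * q) = κ * (1 / q) / 2 := by field_simp
    have : 0 < 1 / (q : ℝ) := by positivity
    rw [e1]
    nlinarith
  have : 0 ≤ (1 - p) * κ * (z i * w i) + κ * κ * (z l * w l) := by positivity
  nlinarith [mul_le_mul_of_nonneg_right hc hS]

/-- Comparison of a single `2 × 2` minor with the divergence of the corresponding pair. -/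
lemma sq_mul_minor_le {z w : Fin q → ℝ} (hz : ∀ i, 0 ≤ z i) (hw : ∀ i, 0 < w i) (k l : Fin q)
    {c μ S r : ℝ} (hc : 0 < c) (hμ : 0 ≤ μ) (hcμ : c * μ ≤ 1) (hr : 0 ≤ r)
    (hS : c * μ * (z k * w l + z l * w k) ≤ S) (hr2 : c * μ * (w k * w l) ≤ r ^ 2) :
    (μ * (z k * w l - z l * w k)) ^ 2 ≤ 2 / c ^ 2 * S * r * affDiv z w k l := by
  have hzk := hz k
  have hzl := hz l
  have hwk := hw k
  have hwl := hw l
  have hs : 0 < √(w k * w l) := Real.sqrt_pos.2 (by positivity)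
  have hs2 : √(w k * w l) ^ 2 = w k * w l := Real.sq_sqrt (by positivity)
  set s := √(w k * w l)
  have ha2 : √(z k * w l) ^ 2 = z k * w l := Real.sq_sqrt (by positivity)
  have hb2 : √(z l * w k) ^ 2 = z l * w k := Real.sq_sqrt (by positivity)
  unfold affDiv
  set a := √(z k * w l)
  set b := √(z l * w k)
  rw [← ha2, ← hb2] at hS ⊢
  rw [← hs2] at hr2
  have hrs : c * μ * s ≤ r := by
    refine (sq_le_sq₀ (by positivity) hr).1 ?_
    calc (c * μ * s) ^ 2 = (c * μ) * (c * μ * s ^ 2) := by ring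
      _ ≤ 1 * (c * μ * s ^ 2) := by gcongr
      _ ≤ r ^ 2 := by linarith
  have hS0 : 0 ≤ S := le_trans (by positivity) hS
  set e := (a - b) ^ 2 / s with he
  have he0 : 0 ≤ e := by positivity
  have hes : (a - b) ^ 2 = e * s := by rw [he]; field_simp
  calc (μ * (a ^ 2 - b ^ 2)) ^ 2 = μ ^ 2 * (a - b) ^ 2 * (a + b) ^ 2 := by ring
    _ ≤ μ ^ 2 * (a - b) ^ 2 * (2 * (a ^ 2 + b ^ 2)) := by
        gcongr
        nlinarith [sq_nonneg (a - b)]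
    _ = 2 / c ^ 2 * (c * μ * (a ^ 2 + b ^ 2)) * (c * μ * s) * e := by
        rw [hes]; field_simp
    _ ≤ 2 / c ^ 2 * S * r * e := by gcongr

lemma sq_sqrt_sub_sqrt_le {A B X : ℝ} (hA : 0 ≤ A) (hB : 0 ≤ B) (hX : 0 ≤ X)
    (h : (A - B) ^ 2 ≤ X * (A + B)) : (√A - √B) ^ 2 ≤ X := by
  have hsA : √A ^ 2 = A := Real.sq_sqrt hA
  have hsB : √B ^ 2 = B := Real.sq_sqrt hB
  rcases (add_nonneg hA hB).eq_or_lt with h0 | h0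
  · have hA' : A = 0 := by linarith
    have hB' : B = 0 := by linarith
    simpa [hA', hB'] using hX
  · have h1 : (√A - √B) ^ 2 * (A + B) ≤ (√A - √B) ^ 2 * (√A + √B) ^ 2 := by
      refine mul_le_mul_of_nonneg_left ?_ (sq_nonneg _)
      nlinarith [mul_nonneg (Real.sqrt_nonneg A) (Real.sqrt_nonneg B)]
    have h2 : (√A - √B) ^ 2 * (√A + √B) ^ 2 = (A - B) ^ 2 := by
      calc (√A - √B) ^ 2 * (√A + √B) ^ 2 = (√A ^ 2 - √B ^ 2) ^ 2 := by ring
        _ = (A - B) ^ 2 := by rw [hsA, hsB]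
    exact le_of_mul_le_mul_right (by linarith) h0

/-- One application of the transition matrix contracts the divergence by `λ²`, up to a constant
depending only on `q`. -/
lemma affDiv_mixVec_le (hq : 3 ≤ q) {p : ℝ} (hp0 : 0 < p) (hp1 : p < 1) {z w : Fin q → ℝ}
    (hz : ∀ i, 0 ≤ z i) (hw : ∀ i, 0 < w i) {i j : Fin q} (hij : i ≠ j) :
    affDiv (mixVec p z) (mixVec p w) i j
      ≤ 72 * (q : ℝ) ^ 4 * (1 - p * q / ((q : ℝ) - 1)) ^ 2 * ∑ k, ∑ l, affDiv z w k l := by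
  have hq' : (3 : ℝ) ≤ q := by exact_mod_cast hq
  have hw' : ∀ i, 0 ≤ w i := fun i => (hw i).le
  have hself := mixVec_cross_self hq hp0 hp1 hz hw' hij
  have hself' := mixVec_cross_self hq hp0 hp1 hw' hw' hij
  have hne := fun l => mixVec_cross_ne (l := l) hq hp0 hp1 hz hw' hij
  have hne' := fun l => mixVec_cross_ne (l := l) hq hp0 hp1 hw' hw' hij
  have hnej := fun l => mixVec_cross_ne (l := l) hq hp0 hp1 hz hw' hij.symm
  have hnej' := fun l => mixVec_cross_ne (l := l) hq hp0 hp1 hw' hw' hij.symm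
  rw [lam_eq hq]
  have hbz := mixVec_nonneg hq hp0 hp1 hz
  have hbw := mixVec_pos hq hp0 hp1 hw' ⟨i, hw i⟩
  have hEi := mixVec_eq p z i
  have hEj := mixVec_eq p z j
  have hFi := mixVec_eq p w i
  have hFj := mixVec_eq p w j
  set κ := p / ((q : ℝ) - 1) with hκ
  set lam := 1 - p - κ with hlam
  have hκ0 : 0 < κ := by apply div_pos hp0; linarith
  have hκp : p = κ * ((q : ℝ) - 1) := by rw [hκ]; field_simp [show (q : ℝ) - 1 ≠ 0 by linarith]
  have hκp' : κ ≤ p := by nlinarith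
  have hlamμ : |lam| ≤ 1 - p + κ := by rw [abs_le]; constructor <;> linarith
  set E := ∑ k, ∑ l, affDiv z w k l with hE
  have hEle : ∀ k l, affDiv z w k l ≤ E := by
    intro k l
    calc affDiv z w k l ≤ ∑ l, affDiv z w k l :=
          Finset.single_le_sum (f := fun l => affDiv z w k l)
            (fun l _ => affDiv_nonneg z w k l) (Finset.mem_univ l)
      _ ≤ E := Finset.single_le_sum (f := fun k => ∑ l, affDiv z w k l)
            (fun k _ => Finset.sum_nonneg fun l _ => affDiv_nonneg z w k l) (Finset.mem_univ k)
  have hE0 : 0 ≤ E := (affDiv_nonneg z w i j).trans (hEle i j)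
  set A := mixVec p z i * mixVec p w j with hA
  set B := mixVec p z j * mixVec p w i with hB
  have hA0 : 0 ≤ A := mul_nonneg (hbz i) (hbw j).le
  have hB0 : 0 ≤ B := mul_nonneg (hbz j) (hbw i).le
  have hrr : 0 < mixVec p w i * mixVec p w j := mul_pos (hbw i) (hbw j)
  have hr : 0 < √(mixVec p w i * mixVec p w j) := Real.sqrt_pos.2 hrr
  have hr2 : √(mixVec p w i * mixVec p w j) ^ 2 = mixVec p w i * mixVec p w j :=
    Real.sq_sqrt hrr.le
  unfold affDiv
  rw [← hA, ← hB]
  set r := √(mixVec p w i * mixVec p w j)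
  set T := √(2 / (1 / (2 * (q : ℝ))) ^ 2 * (A + B) * r * E) with hT
  have hTarg : 0 ≤ 2 / (1 / (2 * (q : ℝ))) ^ 2 * (A + B) * r * E := by positivity
  have hT2 : T ^ 2 = 2 / (1 / (2 * (q : ℝ))) ^ 2 * (A + B) * r * E := Real.sq_sqrt hTarg
  have hT0 : 0 ≤ T := Real.sqrt_nonneg _
  have key : ∀ (μ : ℝ) (k l : Fin q), 0 ≤ μ → μ ≤ 1 →
      μ / (2 * q) * (z k * w l + z l * w k) ≤ A + B →
      μ / (2 * q) * (w k * w l + w l * w k) ≤ 2 * r ^ 2 →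
      μ * |z k * w l - z l * w k| ≤ T := by
    intro μ k l h0 h1 h2 h3
    have := sq_mul_minor_le hz hw k l (c := 1 / (2 * (q : ℝ))) (μ := μ) (S := A + B) (r := r)
      (by positivity) h0 (by
        rw [div_mul_eq_mul_div, div_le_one (by positivity)]; linarith) hr.le
      (by rw [div_mul_eq_mul_div, one_mul]; exact h2)
      (by rw [div_mul_eq_mul_div, one_mul]; linarith)
    rw [← abs_of_nonneg h0, ← abs_mul]
    apply Real.abs_le_sqrt
    refine this.trans ?_
    gcongr
    exact hEle k l
  have hkself : ∀ μ : ℝ, 0 ≤ μ → μ ≤ 1 - p + κ → μ * |z i * w j - z j * w i| ≤ T := by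
    intro μ h0 h1
    refine (mul_le_mul_of_nonneg_right h1 (abs_nonneg _)).trans ?_
    apply key _ i j (by linarith) (by linarith) hself
    rw [hr2]; linarith
  have hκ1 : κ ≤ 1 := by linarith
  have hki : ∀ l, κ * |z i * w l - z l * w i| ≤ T := by
    intro l
    by_cases hil : i = l
    · subst hil; simpa using hT0
    by_cases hjl : j = l
    · subst hjl; exact hkself κ hκ0.le (by linarith)
    apply key _ i l hκ0.le hκ1 (hne l hil hjl)
    rw [hr2]; linarith [hne' l hil hjl]
  have hkj : ∀ l, κ * |z j * w l - z l * w j| ≤ T := by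
    intro l
    by_cases hjl : j = l
    · subst hjl; simpa using hT0
    by_cases hil : i = l
    · subst hil
      rw [abs_sub_comm]
      exact hkself κ hκ0.le (by linarith)
    apply key _ j l hκ0.le hκ1
    · linarith [hnej l hjl hil]
    · rw [hr2]; linarith [hnej' l hjl hil]
  have hAB : A - B = lam * (lam * (z i * w j - z j * w i)
      + κ * ∑ l, ((z i * w l - z l * w i) - (z j * w l - z l * w j))) := by
    rw [hA, hB, hEi, hEj, hFi, hFj]
    simp only [Finset.sum_sub_distrib, ← Finset.mul_sum, ← Finset.sum_mul]
    ring
  have habs : |lam * (z i * w j - z j * w i)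
      + κ * ∑ l, ((z i * w l - z l * w i) - (z j * w l - z l * w j))| ≤ 3 * q * T := by
    have h1 : |lam * (z i * w j - z j * w i)| ≤ T := by
      rw [abs_mul]; exact hkself _ (abs_nonneg _) hlamμ
    have h2 : |κ * ∑ l, ((z i * w l - z l * w i) - (z j * w l - z l * w j))| ≤ q * (2 * T) := by
      rw [abs_mul, abs_of_pos hκ0]
      calc κ * |∑ l, ((z i * w l - z l * w i) - (z j * w l - z l * w j))|
          ≤ κ * ∑ l, |(z i * w l - z l * w i) - (z j * w l - z l * w j)| := by
            gcongr; exact Finset.abs_sum_le_sum_abs _ _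
        _ = ∑ l, κ * |(z i * w l - z l * w i) - (z j * w l - z l * w j)| := Finset.mul_sum _ _ _
        _ ≤ ∑ _l : Fin q, 2 * T := by
            refine Finset.sum_le_sum fun l _ => ?_
            have := mul_le_mul_of_nonneg_left
              (abs_sub (z i * w l - z l * w i) (z j * w l - z l * w j)) hκ0.le
            linarith [hki l, hkj l]
        _ = q * (2 * T) := by simp
    refine (abs_add_le _ _).trans ?_
    nlinarith
  have hsq : (A - B) ^ 2 ≤ lam ^ 2 * (72 * (q : ℝ) ^ 4 * (A + B) * r * E) := by
    rw [hAB, mul_pow]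
    refine mul_le_mul_of_nonneg_left ?_ (sq_nonneg _)
    rw [← sq_abs]
    calc _ ≤ (3 * q * T) ^ 2 := by gcongr
      _ = 72 * (q : ℝ) ^ 4 * (A + B) * r * E := by
          rw [mul_pow, hT2]; field_simp; ring
  rw [div_le_iff₀ hr]
  refine sq_sqrt_sub_sqrt_le hA0 hB0 (mul_nonneg (mul_nonneg (by positivity) hE0) hr.le) ?_
  linarith

end Analysis

section Channels

variable {q : ℕ} {α β : Type} [Fintype α] [Fintype β]

/-- A channel from the labels to a finite alphabet. -/
structure IsChannel (P : Fin q → α → ℝ) : Prop where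
  nonneg : ∀ i o, 0 ≤ P i o
  sum_eq_one : ∀ i, ∑ o, P i o = 1

/-- The Bhattacharyya affinity of two rows of a channel. -/
noncomputable def aff (P : Fin q → α → ℝ) (i j : Fin q) : ℝ := ∑ o, √(P i o * P j o)

/-- The channel from the label of a parent, through one of its children. -/
noncomputable def mixChan (p : ℝ) (P : Fin q → α → ℝ) (i : Fin q) (o : α) : ℝ :=
  mixVec p (fun s => P s o) i

/-- The channel from the label of a parent, through all of its `d` children. -/
noncomputable def stepChan (p : ℝ) (d : ℕ) (P : Fin q → α → ℝ) (i : Fin q) (x : Fin d → α) : ℝ :=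
  ∏ c, mixChan p P i (x c)

/-- `R` is obtained from `P` by passing its output through the stochastic kernel `K`. -/
structure IsDegradation (P : Fin q → α → ℝ) (R : Fin q → β → ℝ) (K : α → β → ℝ) : Prop where
  nonneg : ∀ o t, 0 ≤ K o t
  sum_eq_one : ∀ o, ∑ t, K o t = 1
  eq_sum : ∀ i t, R i t = ∑ o, K o t * P i o

lemma sum_transM (hq : 3 ≤ q) (p : ℝ) (i : Fin q) : ∑ s, transM q p i s = 1 := by
  have hq' : (3 : ℝ) ≤ q := by exact_mod_cast hq
  have h := mixVec_eq p (fun _ : Fin q => (1 : ℝ)) i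
  simp only [mixVec, mul_one, Finset.sum_const, Finset.card_univ, Fintype.card_fin,
    nsmul_eq_mul] at h
  rw [h]
  field_simp [show (q : ℝ) - 1 ≠ 0 by linarith]
  ring

lemma IsChannel.mix (hq : 3 ≤ q) {p : ℝ} (hp0 : 0 < p) (hp1 : p < 1) {P : Fin q → α → ℝ}
    (hP : IsChannel P) : IsChannel (mixChan p P) where
  nonneg i o := mixVec_nonneg hq hp0 hp1 (fun s => hP.nonneg s o) i
  sum_eq_one i := by
    unfold mixChan mixVec
    rw [Finset.sum_comm]
    simp only [← Finset.mul_sum, hP.sum_eq_one, mul_one, sum_transM hq]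

lemma IsChannel.step (hq : 3 ≤ q) {p : ℝ} (hp0 : 0 < p) (hp1 : p < 1) (d : ℕ) {P : Fin q → α → ℝ}
    (hP : IsChannel P) : IsChannel (stepChan p d P) where
  nonneg i x := Finset.prod_nonneg fun c _ => (hP.mix hq hp0 hp1).nonneg i (x c)
  sum_eq_one i := by
    unfold stepChan
    rw [← Fintype.sum_pow, (hP.mix hq hp0 hp1).sum_eq_one, one_pow]

lemma aff_nonneg (P : Fin q → α → ℝ) (i j : Fin q) : 0 ≤ aff P i j :=
  Finset.sum_nonneg fun _ _ => Real.sqrt_nonneg _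

lemma aff_self {P : Fin q → α → ℝ} (hP : IsChannel P) (i : Fin q) : aff P i i = 1 := by
  unfold aff
  rw [← hP.sum_eq_one i]
  exact Finset.sum_congr rfl fun o _ => Real.sqrt_mul_self (hP.nonneg i o)

lemma sqrt_prod' {ι : Type} (s : Finset ι) (f : ι → ℝ) (hf : ∀ c, 0 ≤ f c) :
    √(∏ c ∈ s, f c) = ∏ c ∈ s, √(f c) := by
  classical
  induction s using Finset.induction_on with
  | empty => simp
  | insert a s ha ih => rw [Finset.prod_insert ha, Finset.prod_insert ha, Real.sqrt_mul (hf a), ih]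

lemma aff_step (hq : 3 ≤ q) {p : ℝ} (hp0 : 0 < p) (hp1 : p < 1) (d : ℕ) {P : Fin q → α → ℝ}
    (hP : IsChannel P) (i j : Fin q) :
    aff (stepChan p d P) i j = aff (mixChan p P) i j ^ d := by
  have hM := (hP.mix hq hp0 hp1).nonneg
  unfold aff
  rw [Fintype.sum_pow]
  refine Finset.sum_congr rfl fun x _ => ?_
  unfold stepChan
  rw [← Finset.prod_mul_distrib, sqrt_prod' _ _ fun c => mul_nonneg (hM i (x c)) (hM j (x c))]

lemma one_sub_aff_le {P : Fin q → α → ℝ} (hP : IsChannel P) (i j : Fin q) :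
    1 - aff P i j ≤ (∑ o, |P i o - P j o|) / 2 := by
  have h : ∀ o, (P i o + P j o - |P i o - P j o|) / 2 ≤ √(P i o * P j o) := by
    intro o
    have hi := hP.nonneg i o
    have hj := hP.nonneg j o
    apply Real.le_sqrt_of_sq_le
    rcases abs_cases (P i o - P j o) with ⟨h, h'⟩ | ⟨h, h'⟩ <;> rw [h] <;> nlinarith
  have := Finset.sum_le_sum fun o (_ : o ∈ Finset.univ) => h o
  rw [← Finset.sum_div, Finset.sum_sub_distrib, Finset.sum_add_distrib, hP.sum_eq_one,
    hP.sum_eq_one] at this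
  unfold aff
  linarith

lemma aff_sq_le {P : Fin q → α → ℝ} (hP : IsChannel P) (i j : Fin q) :
    aff P i j ^ 2 ≤ 1 - ((∑ o, |P i o - P j o|) / 2) ^ 2 := by
  have hi := hP.nonneg i
  have hj := hP.nonneg j
  have h1 : ∀ o, |P i o - P j o| = |√(P i o) - √(P j o)| * (√(P i o) + √(P j o)) := by
    intro o
    rw [← abs_of_nonneg (add_nonneg (Real.sqrt_nonneg (P i o)) (Real.sqrt_nonneg (P j o))),
      ← abs_mul]
    congr 1
    nlinarith [Real.sq_sqrt (hi o), Real.sq_sqrt (hj o)]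
  have hm : ∑ o, |√(P i o) - √(P j o)| ^ 2 = 2 - 2 * aff P i j := by
    have : ∀ o, |√(P i o) - √(P j o)| ^ 2 = P i o + P j o - 2 * √(P i o * P j o) := by
      intro o
      rw [sq_abs, Real.sqrt_mul (hi o)]
      nlinarith [Real.sq_sqrt (hi o), Real.sq_sqrt (hj o)]
    simp only [this, Finset.sum_sub_distrib, Finset.sum_add_distrib, hP.sum_eq_one,
      ← Finset.mul_sum, aff]
    ring
  have hp : ∑ o, (√(P i o) + √(P j o)) ^ 2 = 2 + 2 * aff P i j := by
    have : ∀ o, (√(P i o) + √(P j o)) ^ 2 = P i o + P j o + 2 * √(P i o * P j o) := by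
      intro o
      rw [Real.sqrt_mul (hi o)]
      nlinarith [Real.sq_sqrt (hi o), Real.sq_sqrt (hj o)]
    simp only [this, Finset.sum_add_distrib, hP.sum_eq_one, ← Finset.mul_sum, aff]
    ring
  have := Finset.sum_mul_sq_le_sq_mul_sq Finset.univ (fun o => |√(P i o) - √(P j o)|)
    (fun o => √(P i o) + √(P j o))
  simp only [← h1, hm, hp] at this
  nlinarith

lemma aff_le_one {P : Fin q → α → ℝ} (hP : IsChannel P) (i j : Fin q) : aff P i j ≤ 1 := by
  have := aff_sq_le hP i j
  have := sq_nonneg ((∑ o, |P i o - P j o|) / 2)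
  exact (sq_le_one_iff₀ (aff_nonneg P i j)).1 (by linarith)

lemma aff_mix_sq_le (hq : 3 ≤ q) {p : ℝ} (hp0 : 0 < p) (hp1 : p < 1) {P : Fin q → α → ℝ}
    (hP : IsChannel P) (i j : Fin q) :
    aff (mixChan p P) i j ^ 2
      ≤ 1 - (1 - p * q / ((q : ℝ) - 1)) ^ 2 * (1 - aff P i j) ^ 2 := by
  refine (aff_sq_le (hP.mix hq hp0 hp1) i j).trans ?_
  have h : ∀ o, |mixChan p P i o - mixChan p P j o|
      = |1 - p * q / ((q : ℝ) - 1)| * |P i o - P j o| := by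
    intro o
    rw [← abs_mul, lam_eq hq]
    unfold mixChan
    rw [mixVec_eq, mixVec_eq]
    congr 1
    ring
  simp only [h, ← Finset.mul_sum]
  rw [mul_div_assoc, mul_pow, sq_abs]
  have h1 := one_sub_aff_le hP i j
  have h2 : 0 ≤ 1 - aff P i j := by linarith [aff_le_one hP i j]
  gcongr

lemma sqrt_sub_sum_eq {K : α → ℝ} {P : Fin q → α → ℝ} {R : Fin q → ℝ} (hP : ∀ i o, 0 ≤ P i o)
    (hR : ∀ i, 0 < R i) (h : ∀ i, R i = ∑ o, K o * P i o) (i j : Fin q) :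
    √(R i * R j) - ∑ o, K o * √(P i o * P j o)
      = (∑ o, K o * affDiv (fun s => P s o) R i j) / 2 := by
  have hRR : 0 < R i * R j := mul_pos (hR i) (hR j)
  have hs : 0 < √(R i * R j) := Real.sqrt_pos.2 hRR
  have hs2 : √(R i * R j) ^ 2 = R i * R j := Real.sq_sqrt hRR.le
  have hd : ∀ o, affDiv (fun s => P s o) R i j
      = (P i o * R j + P j o * R i) / √(R i * R j) - 2 * √(P i o * P j o) := by
    intro o
    have h1 : 0 ≤ P i o * R j := mul_nonneg (hP i o) (hR j).le
    have h2 : 0 ≤ P j o * R i := mul_nonneg (hP j o) (hR i).le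
    have h3 : √(P i o * R j) * √(P j o * R i) = √(P i o * P j o) * √(R i * R j) := by
      rw [← Real.sqrt_mul h1, ← Real.sqrt_mul (mul_nonneg (hP i o) (hP j o))]
      congr 1
      ring
    unfold affDiv
    rw [sub_sq, Real.sq_sqrt h1, Real.sq_sqrt h2, mul_assoc, h3]
    generalize √(R i * R j) = s at hs
    field_simp
    ring
  have h4 : ∑ o, K o * ((P i o * R j + P j o * R i) / √(R i * R j)) = 2 * √(R i * R j) := by
    have : ∀ o, K o * ((P i o * R j + P j o * R i) / √(R i * R j))
        = (K o * P i o) * (R j / √(R i * R j)) + (K o * P j o) * (R i / √(R i * R j)) := by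
      intro o; ring
    rw [Finset.sum_congr rfl fun o _ => this o, Finset.sum_add_distrib, ← Finset.sum_mul,
      ← Finset.sum_mul, ← h, ← h]
    field_simp
    rw [hs2]
    ring
  have h5 : ∑ o, K o * affDiv (fun s => P s o) R i j
      = 2 * √(R i * R j) - 2 * ∑ o, K o * √(P i o * P j o) := by
    rw [← h4, Finset.mul_sum, ← Finset.sum_sub_distrib]
    refine Finset.sum_congr rfl fun o _ => ?_
    rw [hd]; ring
  rw [h5]; ring

lemma aff_sub_aff_eq {P : Fin q → α → ℝ} {R : Fin q → β → ℝ} {K : α → β → ℝ}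
    (hK : IsDegradation P R K) (hP : ∀ i o, 0 ≤ P i o) (hR : ∀ i t, 0 < R i t) (i j : Fin q) :
    aff R i j - aff P i j
      = (∑ t, ∑ o, K o t * affDiv (fun s => P s o) (fun s => R s t) i j) / 2 := by
  have h1 : aff P i j = ∑ t, ∑ o, K o t * √(P i o * P j o) := by
    rw [Finset.sum_comm]
    simp only [← Finset.sum_mul, hK.sum_eq_one, one_mul, aff]
  rw [h1]
  unfold aff
  rw [← Finset.sum_sub_distrib, Finset.sum_div]
  exact Finset.sum_congr rfl fun t _ =>
    sqrt_sub_sum_eq hP (fun i => hR i t) (fun i => hK.eq_sum i t) i j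

lemma IsDegradation.mix {P : Fin q → α → ℝ} {R : Fin q → β → ℝ} {K : α → β → ℝ}
    (hK : IsDegradation P R K) (p : ℝ) : IsDegradation (mixChan p P) (mixChan p R) K where
  nonneg := hK.nonneg
  sum_eq_one := hK.sum_eq_one
  eq_sum i t := by
    unfold mixChan mixVec
    simp only [hK.eq_sum, Finset.mul_sum]
    rw [Finset.sum_comm]
    refine Finset.sum_congr rfl fun o _ => Finset.sum_congr rfl fun s _ => ?_
    ring

lemma IsDegradation.step {P : Fin q → α → ℝ} {R : Fin q → β → ℝ} {K : α → β → ℝ}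
    (hK : IsDegradation P R K) (p : ℝ) (d : ℕ) :
    IsDegradation (stepChan p d P) (stepChan p d R) fun x y => ∏ c, K (x c) (y c) where
  nonneg x y := Finset.prod_nonneg fun c _ => hK.nonneg _ _
  sum_eq_one x := by
    classical
    rw [← Fintype.prod_sum (f := fun c t => K (x c) t)]
    simp [hK.sum_eq_one]
  eq_sum i y := by
    classical
    unfold stepChan
    simp only [(hK.mix p).eq_sum, ← Finset.prod_mul_distrib]
    rw [Fintype.prod_sum]

/-- The total affinity gap between a channel and a degraded version of it. -/
noncomputable def affGap (P : Fin q → α → ℝ) (R : Fin q → β → ℝ) : ℝ :=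
  ∑ k, ∑ l, (aff R k l - aff P k l)

lemma affGap_eq {P : Fin q → α → ℝ} {R : Fin q → β → ℝ} {K : α → β → ℝ}
    (hK : IsDegradation P R K) (hP : ∀ i o, 0 ≤ P i o) (hR : ∀ i t, 0 < R i t) :
    affGap P R
      = (∑ t, ∑ o, K o t * ∑ k, ∑ l, affDiv (fun s => P s o) (fun s => R s t) k l) / 2 := by
  unfold affGap
  simp only [aff_sub_aff_eq hK hP hR, ← Finset.sum_div]
  congr 1
  simp only [Finset.mul_sum]
  calc _ = ∑ k, ∑ t, ∑ l, ∑ o, K o t * affDiv (fun s => P s o) (fun s => R s t) k l :=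
        Finset.sum_congr rfl fun k _ => Finset.sum_comm
    _ = ∑ t, ∑ k, ∑ o, ∑ l, K o t * affDiv (fun s => P s o) (fun s => R s t) k l := by
        rw [Finset.sum_comm]
        exact Finset.sum_congr rfl fun t _ => Finset.sum_congr rfl fun k _ => Finset.sum_comm
    _ = _ := Finset.sum_congr rfl fun t _ => Finset.sum_comm

lemma affGap_nonneg {P : Fin q → α → ℝ} {R : Fin q → β → ℝ} {K : α → β → ℝ}
    (hK : IsDegradation P R K) (hP : ∀ i o, 0 ≤ P i o) (hR : ∀ i t, 0 < R i t) :
    0 ≤ affGap P R := by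
  rw [affGap_eq hK hP hR]
  refine div_nonneg (Finset.sum_nonneg fun t _ => Finset.sum_nonneg fun o _ =>
    mul_nonneg (hK.nonneg o t) (Finset.sum_nonneg fun k _ => Finset.sum_nonneg fun l _ =>
      affDiv_nonneg _ _ k l)) zero_le_two

lemma aff_mix_sub_le (hq : 3 ≤ q) {p : ℝ} (hp0 : 0 < p) (hp1 : p < 1) {P : Fin q → α → ℝ}
    {R : Fin q → β → ℝ} {K : α → β → ℝ} (hK : IsDegradation P R K) (hP : ∀ i o, 0 ≤ P i o)
    (hR : ∀ i t, 0 < R i t) {i j : Fin q} (hij : i ≠ j) :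
    aff (mixChan p R) i j - aff (mixChan p P) i j
      ≤ 72 * (q : ℝ) ^ 4 * (1 - p * q / ((q : ℝ) - 1)) ^ 2 * affGap P R := by
  rw [aff_sub_aff_eq (hK.mix p) (fun i o => mixVec_nonneg hq hp0 hp1 (fun s => hP s o) i)
    (fun k t => mixVec_pos hq hp0 hp1 (fun s => (hR s t).le) ⟨i, hR i t⟩ k), affGap_eq hK hP hR,
    ← mul_div_assoc]
  refine div_le_div_of_nonneg_right ?_ zero_le_two
  rw [Finset.mul_sum]
  refine Finset.sum_le_sum fun t _ => ?_
  rw [Finset.mul_sum]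
  refine Finset.sum_le_sum fun o _ => ?_
  rw [mul_left_comm]
  exact mul_le_mul_of_nonneg_left
    (affDiv_mixVec_le hq hp0 hp1 (fun s => hP s o) (fun s => hR s t) hij) (hK.nonneg o t)

lemma pow_sub_pow_le_mul {a b : ℝ} (ha : 0 ≤ a) (hab : a ≤ b) (n : ℕ) :
    b ^ n - a ^ n ≤ n * b ^ (n - 1) * (b - a) := by
  rw [← Commute.geom_sum₂_mul (Commute.all b a)]
  refine mul_le_mul_of_nonneg_right ?_ (by linarith)
  calc ∑ i ∈ Finset.range n, b ^ i * a ^ (n - 1 - i)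
      ≤ ∑ i ∈ Finset.range n, b ^ (n - 1) := by
        refine Finset.sum_le_sum fun i hi => ?_
        have hi' := Finset.mem_range.1 hi
        calc b ^ i * a ^ (n - 1 - i) ≤ b ^ i * b ^ (n - 1 - i) := by
              have hb := ha.trans hab
              gcongr
          _ = b ^ (n - 1) := by rw [← pow_add]; congr 1; omega
    _ = n * b ^ (n - 1) := by simp

/-- The threshold on the signal-to-noise ratio. -/
noncomputable def snrThreshold (q : ℕ) : ℝ := 10 ^ 10 * (q : ℝ) ^ 6

lemma aff_mix_le_exp (hq : 3 ≤ q) {p : ℝ} (hp0 : 0 < p) (hp1 : p < 1) {R : Fin q → β → ℝ}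
    (hR : IsChannel R) {i j : Fin q} (h : aff R i j ≤ 19 / 20) :
    aff (mixChan p R) i j ≤ Real.exp (-((1 - p * q / ((q : ℝ) - 1)) ^ 2 / 800)) := by
  set lam := 1 - p * q / ((q : ℝ) - 1) with hlam
  have h1 := aff_mix_sq_le hq hp0 hp1 hR i j
  rw [← hlam] at h1
  have h2 : (1 / 20 : ℝ) ^ 2 ≤ (1 - aff R i j) ^ 2 := by
    apply pow_le_pow_left₀ (by norm_num); linarith
  refine (sq_le_sq₀ (aff_nonneg _ i j) (Real.exp_pos _).le).1 ?_
  rw [← Real.exp_nat_mul]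
  have h3 := Real.add_one_le_exp (((2 : ℕ) : ℝ) * -(lam ^ 2 / 800))
  push_cast at h3 ⊢
  nlinarith [mul_le_mul_of_nonneg_left h2 (sq_nonneg lam)]

lemma aff_step_le (hq : 3 ≤ q) {p : ℝ} (hp0 : 0 < p) (hp1 : p < 1) {d : ℕ}
    (hC : snrThreshold q < (1 - p * q / ((q : ℝ) - 1)) ^ 2 * d) {R : Fin q → β → ℝ}
    (hR : IsChannel R) {i j : Fin q} (h : aff R i j ≤ 19 / 20) :
    aff (stepChan p d R) i j ≤ 19 / 20 := by
  have hq' : (3 : ℝ) ≤ q := by exact_mod_cast hq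
  have h1 := aff_mix_le_exp hq hp0 hp1 hR h
  rw [aff_step hq hp0 hp1 d hR]
  refine (pow_le_pow_left₀ (aff_nonneg _ i j) h1 d).trans ?_
  rw [← Real.exp_nat_mul]
  have h6 : (3 : ℝ) ^ 6 ≤ (q : ℝ) ^ 6 := by gcongr
  unfold snrThreshold at hC
  set u := (1 - p * q / ((q : ℝ) - 1)) ^ 2 * d with hu
  have e : (d : ℝ) * -((1 - p * q / ((q : ℝ) - 1)) ^ 2 / 800) = -(u / 800) := by rw [hu]; ring
  rw [e, Real.exp_neg]
  have h3 := Real.add_one_le_exp (u / 800)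
  rw [inv_le_comm₀ (Real.exp_pos _) (by norm_num)]
  linarith

/-- Above the threshold, one level of the tree contracts the affinity gap. -/
lemma affGap_step_le (hq : 3 ≤ q) {p : ℝ} (hp0 : 0 < p) (hp1 : p < 1) {d : ℕ}
    (hC : snrThreshold q < (1 - p * q / ((q : ℝ) - 1)) ^ 2 * d) {P : Fin q → α → ℝ}
    {R : Fin q → β → ℝ} {K : α → β → ℝ} (hK : IsDegradation P R K) (hP : IsChannel P)
    (hR : IsChannel R) (hR' : ∀ i t, 0 < R i t) (h : ∀ i j, i ≠ j → aff R i j ≤ 19 / 20) :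
    affGap (stepChan p d P) (stepChan p d R) ≤ 1 / 4 * affGap P R := by
  have hq' : (3 : ℝ) ≤ q := by exact_mod_cast hq
  have h6 : (3 : ℝ) ^ 6 ≤ (q : ℝ) ^ 6 := by gcongr
  have hG := affGap_nonneg hK hP.nonneg hR'
  set G := affGap P R with hGdef
  have hlam1 : (1 - p * q / ((q : ℝ) - 1)) ^ 2 ≤ 1 := by
    rw [sq_le_one_iff_abs_le_one, lam_eq hq]
    have : 0 < p / ((q : ℝ) - 1) := div_pos hp0 (by linarith)
    have : p / ((q : ℝ) - 1) ≤ 1 := by rw [div_le_one (by linarith)]; linarith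
    rw [abs_le]; constructor <;> linarith
  have hterm : ∀ i j, aff (stepChan p d R) i j - aff (stepChan p d P) i j
      ≤ 1 / (4 * (q : ℝ) ^ 2) * G := by
    intro i j
    by_cases hij : i = j
    · subst hij
      rw [aff_self (hR.step hq hp0 hp1 d), aff_self (hP.step hq hp0 hp1 d), sub_self]
      positivity
    have h1 := aff_mix_le_exp hq hp0 hp1 hR (h i j hij)
    have h2 := aff_mix_sub_le hq hp0 hp1 hK hP.nonneg hR' hij
    have h3 : aff (mixChan p P) i j ≤ aff (mixChan p R) i j := by
      rw [← sub_nonneg, aff_sub_aff_eq (hK.mix p) (hP.mix hq hp0 hp1).nonneg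
        (fun k t => mixVec_pos hq hp0 hp1 (fun s => (hR' s t).le) ⟨i, hR' i t⟩ k)]
      exact div_nonneg (Finset.sum_nonneg fun t _ => Finset.sum_nonneg fun o _ =>
        mul_nonneg (hK.nonneg o t) (affDiv_nonneg _ _ i j)) zero_le_two
    rw [aff_step hq hp0 hp1 d hR, aff_step hq hp0 hp1 d hP]
    refine (pow_sub_pow_le_mul (aff_nonneg _ i j) h3 d).trans ?_
    unfold snrThreshold at hC
    set lam2 := (1 - p * q / ((q : ℝ) - 1)) ^ 2 with hlam2
    have hd2 : 2 ≤ d := by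
      by_contra! hlt
      have : (d : ℝ) ≤ 1 := by exact_mod_cast Nat.lt_succ_iff.1 hlt
      have h0 : 0 ≤ lam2 := sq_nonneg _
      nlinarith
    have hpow : aff (mixChan p R) i j ^ (d - 1) ≤ Real.exp (-(lam2 * d / 1600)) := by
      refine (pow_le_pow_left₀ (aff_nonneg _ i j) h1 (d - 1)).trans ?_
      rw [← Real.exp_nat_mul, Real.exp_le_exp]
      have h0 : 0 ≤ lam2 := sq_nonneg _
      have hd2' : (2 : ℝ) ≤ d := by exact_mod_cast hd2
      rw [Nat.cast_sub (by omega)]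
      push_cast
      nlinarith
    set u := lam2 * d with hu
    have hu0 : 0 < u := lt_of_le_of_lt (by positivity) hC
    have hexp : Real.exp (-(u / 1600)) ≤ 2 * 1600 ^ 2 / u ^ 2 := by
      rw [Real.exp_neg, inv_le_comm₀ (Real.exp_pos _) (by positivity), inv_div]
      have := Real.quadratic_le_exp_of_nonneg (x := u / 1600) (by positivity)
      refine le_trans ?_ this
      have : u ^ 2 / (2 * 1600 ^ 2) = (u / 1600) ^ 2 / 2 := by ring
      rw [this]
      have : 0 ≤ u / 1600 := by positivity
      linarith
    calc d * aff (mixChan p R) i j ^ (d - 1) * (aff (mixChan p R) i j - aff (mixChan p P) i j)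
        ≤ d * (2 * 1600 ^ 2 / u ^ 2) * (72 * (q : ℝ) ^ 4 * lam2 * G) := by
          refine mul_le_mul ?_ h2 (by linarith) (by positivity)
          gcongr
          exact hpow.trans hexp
      _ = (144 * 1600 ^ 2 * (q : ℝ) ^ 4 / u) * G := by
          have : (d : ℝ) * lam2 = u := by rw [hu]; ring
          field_simp
          rw [← this]
          ring
      _ ≤ 1 / (4 * (q : ℝ) ^ 2) * G := by
          refine mul_le_mul_of_nonneg_right ?_ hG
          rw [div_le_div_iff₀ hu0 (by positivity)]
          nlinarith
  calc affGap (stepChan p d P) (stepChan p d R)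
      ≤ ∑ _i : Fin q, ∑ _j : Fin q, 1 / (4 * (q : ℝ) ^ 2) * G :=
        Finset.sum_le_sum fun i _ => Finset.sum_le_sum fun j _ => hterm i j
    _ = 1 / 4 * G := by
        simp only [Finset.sum_const, Finset.card_univ, Fintype.card_fin, nsmul_eq_mul]
        field_simp

end Channels

section Success

variable {q : ℕ} {α β : Type} [Fintype α] [Fintype β]

lemma le_iSup_fin (z : Fin q → ℝ) (k : Fin q) : z k ≤ ⨆ i, z i :=
  le_ciSup (Set.finite_range z).bddAbove k

lemma le_ratio_mul_iSup_add {z w : Fin q → ℝ} (hz : ∀ i, 0 ≤ z i) (hw : ∀ i, 0 < w i)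
    {δ : ℝ} (hδ : 0 < δ) (k : Fin q) :
    z k ≤ (∑ i, z i) / (∑ i, w i) * (⨆ i, w i) + δ⁻¹ * (∑ k, ∑ l, affDiv z w k l)
      + 4 * δ * ∑ i, z i := by
  set Z := ∑ i, z i with hZ
  set W := ∑ i, w i with hW
  have hW0 : 0 < W := Finset.sum_pos (fun i _ => hw i) ⟨k, Finset.mem_univ _⟩
  have hzZ : ∀ i, z i ≤ Z := fun i => Finset.single_le_sum (fun i _ => hz i) (Finset.mem_univ i)
  have hwW : ∀ i, w i ≤ W := fun i =>
    Finset.single_le_sum (fun i _ => (hw i).le) (Finset.mem_univ i)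
  have hZ0 : 0 ≤ Z := (hz k).trans (hzZ k)
  have hminor : ∀ l, z k * w l - z l * w k
      ≤ δ⁻¹ * (affDiv z w k l * W) + δ * (2 * (z k * w l + z l * w k)) := by
    intro l
    have ha : √(z k * w l) ^ 2 = z k * w l := Real.sq_sqrt (mul_nonneg (hz k) (hw l).le)
    have hb : √(z l * w k) ^ 2 = z l * w k := Real.sq_sqrt (mul_nonneg (hz l) (hw k).le)
    have hs : 0 < √(w k * w l) := Real.sqrt_pos.2 (mul_pos (hw k) (hw l))
    have hsW : √(w k * w l) ≤ W := by
      rw [Real.sqrt_le_left hW0.le, sq]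
      exact mul_le_mul (hwW k) (hwW l) (hw l).le hW0.le
    have he : (√(z k * w l) - √(z l * w k)) ^ 2 ≤ affDiv z w k l * W := by
      calc (√(z k * w l) - √(z l * w k)) ^ 2 = affDiv z w k l * √(w k * w l) := by
            unfold affDiv; rw [div_mul_cancel₀ _ hs.ne']
        _ ≤ affDiv z w k l * W := mul_le_mul_of_nonneg_left hsW (affDiv_nonneg z w k l)
    set a := √(z k * w l)
    set b := √(z l * w k)
    rw [← ha, ← hb]
    have h1 : a ^ 2 - b ^ 2 ≤ δ⁻¹ * (a - b) ^ 2 + δ * (a + b) ^ 2 := by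
      have : δ⁻¹ * (a - b) ^ 2 + δ * (a + b) ^ 2 - (a ^ 2 - b ^ 2)
          = δ⁻¹ * (((a - b) - δ * (a + b) / 2) ^ 2 + 3 / 4 * (δ * (a + b)) ^ 2) := by
        field_simp
        ring
      have h2 : 0 ≤ δ⁻¹ * (((a - b) - δ * (a + b) / 2) ^ 2 + 3 / 4 * (δ * (a + b)) ^ 2) := by
        positivity
      linarith
    have h2 : (a + b) ^ 2 ≤ 2 * (a ^ 2 + b ^ 2) := by nlinarith [sq_nonneg (a - b)]
    have h3 := mul_le_mul_of_nonneg_left h2 hδ.le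
    have h4 := mul_le_mul_of_nonneg_left he (inv_pos.2 hδ).le
    linarith
  have hsum := Finset.sum_le_sum fun l (_ : l ∈ Finset.univ) => hminor l
  simp only [Finset.sum_sub_distrib, Finset.sum_add_distrib, ← Finset.mul_sum, ← Finset.sum_mul]
    at hsum
  rw [← hZ, ← hW] at hsum
  have hE : ∑ l, affDiv z w k l ≤ ∑ k, ∑ l, affDiv z w k l :=
    Finset.single_le_sum (f := fun k => ∑ l, affDiv z w k l)
      (fun k _ => Finset.sum_nonneg fun l _ => affDiv_nonneg z w k l) (Finset.mem_univ k)
  set E := ∑ k, ∑ l, affDiv z w k l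
  have h5 : δ⁻¹ * ((∑ l, affDiv z w k l) * W) ≤ δ⁻¹ * (E * W) := by gcongr
  have h6 : δ * (2 * (z k * W + Z * w k)) ≤ δ * (2 * (Z * W + Z * W)) := by
    have := hzZ k
    have := hwW k
    gcongr
  have h7 : Z * w k ≤ Z * ⨆ i, w i := mul_le_mul_of_nonneg_left (le_iSup_fin w k) hZ0
  refine le_of_mul_le_mul_right ?_ hW0
  calc z k * W ≤ Z * (⨆ i, w i) + δ⁻¹ * (E * W) + δ * (2 * (Z * W + Z * W)) := by linarith
    _ = _ := by field_simp; ring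

/-- `q` times the success probability of optimal reconstruction through a channel from the uniform
distribution on the labels. -/
noncomputable def totalSuccess (P : Fin q → α → ℝ) : ℝ := ∑ o, ⨆ i, P i o

lemma totalSuccess_eq_sum {P : Fin q → α → ℝ} {R : Fin q → β → ℝ} {K : α → β → ℝ}
    (hK : IsDegradation P R K) : totalSuccess P = ∑ t, ∑ o, K o t * ⨆ i, P i o := by
  rw [Finset.sum_comm]
  simp only [← Finset.sum_mul, hK.sum_eq_one, one_mul, totalSuccess]

lemma totalSuccess_le (hq : 3 ≤ q) {P : Fin q → α → ℝ} {R : Fin q → β → ℝ} {K : α → β → ℝ}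
    (hK : IsDegradation P R K) : totalSuccess R ≤ totalSuccess P := by
  have : Nonempty (Fin q) := ⟨⟨0, by omega⟩⟩
  rw [totalSuccess_eq_sum hK]
  refine Finset.sum_le_sum fun t _ => ciSup_le fun i => ?_
  rw [hK.eq_sum]
  exact Finset.sum_le_sum fun o _ =>
    mul_le_mul_of_nonneg_left (le_iSup_fin (fun i => P i o) i) (hK.nonneg o t)

lemma totalSuccess_sub_le (hq : 3 ≤ q) {P : Fin q → α → ℝ} {R : Fin q → β → ℝ} {K : α → β → ℝ}
    (hK : IsDegradation P R K) (hP : IsChannel P) (hR : ∀ i t, 0 < R i t) {δ : ℝ} (hδ : 0 < δ) :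
    totalSuccess P - totalSuccess R ≤ δ⁻¹ * (2 * affGap P R) + 4 * δ * q := by
  have : Nonempty (Fin q) := ⟨⟨0, by omega⟩⟩
  have hpt : ∀ t o, K o t * ⨆ i, P i o
      ≤ (K o t * ∑ i, P i o) * ((⨆ i, R i t) / ∑ i, R i t)
        + δ⁻¹ * (K o t * ∑ k, ∑ l, affDiv (fun s => P s o) (fun s => R s t) k l)
        + 4 * δ * (K o t * ∑ i, P i o) := by
    intro t o
    have h := mul_le_mul_of_nonneg_left (ciSup_le fun k => le_ratio_mul_iSup_add
      (fun s => hP.nonneg s o) (fun s => hR s t) hδ k) (hK.nonneg o t)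
    refine h.trans (le_of_eq ?_)
    ring
  have hZ : ∀ t, ∑ o, K o t * ∑ i, P i o = ∑ i, R i t := by
    intro t
    simp only [hK.eq_sum, Finset.mul_sum]
    exact Finset.sum_comm
  have hZpos : ∀ t, 0 < ∑ i, R i t := fun t =>
    Finset.sum_pos (fun i _ => hR i t) Finset.univ_nonempty
  have hq1 : ∑ t, ∑ o, K o t * ∑ i, P i o = q := by
    rw [Finset.sum_comm]
    simp only [← Finset.sum_mul, hK.sum_eq_one, one_mul]
    rw [Finset.sum_comm]
    simp [hP.sum_eq_one]
  have hsum := Finset.sum_le_sum fun t (_ : t ∈ Finset.univ) =>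
    Finset.sum_le_sum fun o (_ : o ∈ Finset.univ) => hpt t o
  simp only [Finset.sum_add_distrib, ← Finset.mul_sum] at hsum
  rw [← totalSuccess_eq_sum hK, hq1] at hsum
  have h1 : ∑ t, ∑ o, (K o t * ∑ i, P i o) * ((⨆ i, R i t) / ∑ i, R i t) = totalSuccess R := by
    unfold totalSuccess
    refine Finset.sum_congr rfl fun t _ => ?_
    rw [← Finset.sum_mul, hZ, mul_div_cancel₀ _ (hZpos t).ne']
  rw [h1] at hsum
  rw [affGap_eq hK hP.nonneg hR]
  linarith

end Success

section Tree

variable {q d : ℕ}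

/-- Likelihood of the leaf observations given the label of the root, where `φ f s` is the
likelihood of the observation at the leaf `f` when its label is `s`. -/
noncomputable def rootLik (p : ℝ) : (m : ℕ) → ((Fin m → Fin d) → Fin q → ℝ) → Fin q → ℝ
  | 0, φ => φ Fin.elim0
  | m + 1, φ => rootLik p m fun f s =>
      ∏ i : Fin d, mixVec p (φ (Fin.cons (α := fun _ => Fin d) i f)) s

lemma rootLik_succ (p : ℝ) (m : ℕ) (φ : (Fin (m + 1) → Fin d) → Fin q → ℝ) (i : Fin q) :
    rootLik p (m + 1) φ i
      = ∏ c : Fin d, mixVec p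
          (rootLik p m fun f => φ (Fin.snoc (α := fun _ => Fin d) f c)) i := by
  induction m generalizing i with
  | zero =>
    simp only [rootLik]
    refine Finset.prod_congr rfl fun c _ => ?_
    congr 2
    funext k
    fin_cases k
    rfl
  | succ m ih =>
    rw [rootLik, ih]
    refine Finset.prod_congr rfl fun c _ => ?_
    congr 1
    simp only [Fin.cons_snoc_eq_snoc_cons]
    rfl

/-- The channel from the root label to the observations at depth `m`, each leaf label being
observed through `W`. -/
noncomputable def leafChan (d : ℕ) (p : ℝ) (W : Fin q → Fin q → ℝ) (m : ℕ) (i : Fin q)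
    (o : (Fin m → Fin d) → Fin q) : ℝ :=
  rootLik p m (fun f s => W s (o f)) i

/-- Splitting a labelling of the depth `m + 1` leaves according to the child of the root. -/
def leafSplit (d m : ℕ) (γ : Type) :
    ((Fin (m + 1) → Fin d) → γ) ≃ (Fin d → (Fin m → Fin d) → γ) where
  toFun o c f := o (Fin.snoc (α := fun _ => Fin d) f c)
  invFun x g := x (g (Fin.last m)) (Fin.init g)
  left_inv o := by ext g; simp
  right_inv x := by ext c f; simp

lemma leafChan_succ (p : ℝ) (W : Fin q → Fin q → ℝ) (m : ℕ) :
    leafChan d p W (m + 1)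
      = fun i o => stepChan p d (leafChan d p W m) i (leafSplit d m (Fin q) o) := by
  ext i o
  unfold leafChan
  rw [rootLik_succ]
  rfl

/-- The properties of the pair of exact and noisy leaf channels that propagate along the tree. -/
structure IsGoodPair {α β : Type} [Fintype α] [Fintype β] (P : Fin q → α → ℝ)
    (R : Fin q → β → ℝ) : Prop where
  degradation : ∃ K, IsDegradation P R K
  left : IsChannel P
  right : IsChannel R
  aff_le : ∀ i j, i ≠ j → aff R i j ≤ 19 / 20
  exists_pos : ∀ t, ∃ s, 0 < R s t

section

variable {α β α' β' : Type} [Fintype α] [Fintype β] [Fintype α'] [Fintype β']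

lemma aff_comp (P : Fin q → α → ℝ) (e : α' ≃ α) (i j : Fin q) :
    aff (fun i o => P i (e o)) i j = aff P i j :=
  e.sum_comp fun o => √(P i o * P j o)

lemma affGap_comp (P : Fin q → α → ℝ) (R : Fin q → β → ℝ) (e : α' ≃ α) (f : β' ≃ β) :
    affGap (fun i o => P i (e o)) (fun i o => R i (f o)) = affGap P R := by
  simp only [affGap, aff_comp]

lemma IsChannel.comp {P : Fin q → α → ℝ} (hP : IsChannel P) (e : α' ≃ α) :
    IsChannel fun i o => P i (e o) where
  nonneg i o := hP.nonneg i (e o)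
  sum_eq_one i := (e.sum_comp fun o => P i o).trans (hP.sum_eq_one i)

lemma IsDegradation.comp {P : Fin q → α → ℝ} {R : Fin q → β → ℝ} {K : α → β → ℝ}
    (hK : IsDegradation P R K) (e : α' ≃ α) (f : β' ≃ β) :
    IsDegradation (fun i o => P i (e o)) (fun i t => R i (f t)) fun o t => K (e o) (f t) where
  nonneg _ _ := hK.nonneg _ _
  sum_eq_one o := (f.sum_comp (K (e o))).trans (hK.sum_eq_one _)
  eq_sum i t := (hK.eq_sum i (f t)).trans (e.sum_comp fun o => K o (f t) * P i o).symm

lemma IsGoodPair.comp {P : Fin q → α → ℝ} {R : Fin q → β → ℝ} (h : IsGoodPair P R)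
    (e : α' ≃ α) (f : β' ≃ β) :
    IsGoodPair (fun i o => P i (e o)) (fun i t => R i (f t)) where
  degradation := h.degradation.imp' _ fun _ hK => hK.comp e f
  left := h.left.comp e
  right := h.right.comp f
  aff_le i j hij := by rw [aff_comp]; exact h.aff_le i j hij
  exists_pos t := h.exists_pos (f t)

lemma IsGoodPair.step_pos (hq : 3 ≤ q) {p : ℝ} (hp0 : 0 < p) (hp1 : p < 1) {P : Fin q → α → ℝ}
    {R : Fin q → β → ℝ} (h : IsGoodPair P R) (i : Fin q) (t : Fin d → β) :
    0 < stepChan p d R i t :=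
  Finset.prod_pos fun c _ =>
    mixVec_pos hq hp0 hp1 (fun s => h.right.nonneg s (t c)) (h.exists_pos (t c)) i

lemma IsGoodPair.step (hq : 3 ≤ q) {p : ℝ} (hp0 : 0 < p) (hp1 : p < 1)
    (hC : snrThreshold q < (1 - p * q / ((q : ℝ) - 1)) ^ 2 * d) {P : Fin q → α → ℝ}
    {R : Fin q → β → ℝ} (h : IsGoodPair P R) : IsGoodPair (stepChan p d P) (stepChan p d R) where
  degradation := h.degradation.imp' _ fun _ hK => hK.step p d
  left := h.left.step hq hp0 hp1 d
  right := h.right.step hq hp0 hp1 d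
  aff_le i j hij := aff_step_le hq hp0 hp1 hC h.right (h.aff_le i j hij)
  exists_pos t := ⟨⟨0, by omega⟩, h.step_pos hq hp0 hp1 _ t⟩

end

lemma isGoodPair_one (hq : 3 ≤ q) {Δ : Fin q → Fin q → ℝ} (h0 : ∀ i j, 0 ≤ Δ i j)
    (hcol : ∀ j, ∑ i, Δ i j = 1) (hrow : ∀ i, ∑ j, Δ i j = 1)
    (hdiag : ∀ i, 1 - 1 / (q : ℝ) ≤ Δ i i) :
    IsGoodPair (fun i j : Fin q => if i = j then (1 : ℝ) else 0) Δ := by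
  have hq' : (3 : ℝ) ≤ q := by exact_mod_cast hq
  have hq3 : 1 / (q : ℝ) ≤ 1 / 3 := one_div_le_one_div_of_le (by norm_num) hq'
  have hΔ : IsChannel Δ := ⟨h0, hrow⟩
  refine ⟨⟨Δ, h0, hrow, fun i t => by simp⟩, ⟨fun i j => by split_ifs <;> norm_num,
    fun i => by simp⟩, hΔ, fun i j hij => ?_, fun t => ⟨t, by linarith [hdiag t]⟩⟩
  have hoff : ∀ k l, k ≠ l → Δ k l ≤ 1 / 3 := by
    intro k l hkl
    have := Finset.sum_le_sum_of_subset_of_nonneg (Finset.subset_univ {k, l})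
      fun s _ _ => h0 s l
    rw [Finset.sum_pair hkl, hcol] at this
    linarith [hdiag l]
  have h2 : |Δ i i - Δ j i| + |Δ i j - Δ j j| ≤ ∑ t, |Δ i t - Δ j t| := by
    rw [← Finset.sum_pair hij (f := fun t => |Δ i t - Δ j t|)]
    exact Finset.sum_le_sum_of_subset_of_nonneg (Finset.subset_univ _)
      fun s _ _ => abs_nonneg _
  have h3 := le_abs_self (Δ i i - Δ j i)
  have h4 := neg_abs_le (Δ i j - Δ j j)
  have h5 := hoff i j hij
  have h6 := hoff j i hij.symm
  have h7 := hdiag i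
  have h8 := hdiag j
  have h9 : 1 / 3 ≤ (∑ t, |Δ i t - Δ j t|) / 2 := by linarith
  have h10 := aff_sq_le hΔ i j
  have h11 := pow_le_pow_left₀ (by norm_num) h9 2
  refine (sq_le_sq₀ (aff_nonneg _ i j) (by norm_num)).1 ?_
  norm_num at h11 ⊢
  linarith

lemma isGoodPair_leafChan (hq : 3 ≤ q) {p : ℝ} (hp0 : 0 < p) (hp1 : p < 1)
    (hC : snrThreshold q < (1 - p * q / ((q : ℝ) - 1)) ^ 2 * d) {V W : Fin q → Fin q → ℝ}
    (h : IsGoodPair V W) (m : ℕ) : IsGoodPair (leafChan d p V m) (leafChan d p W m) := by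
  induction m with
  | zero => exact h.comp (Equiv.funUnique _ _) (Equiv.funUnique _ _)
  | succ m ih =>
    rw [leafChan_succ, leafChan_succ]
    exact (ih.step hq hp0 hp1 hC).comp _ _

lemma leafChan_succ_pos (hq : 3 ≤ q) {p : ℝ} (hp0 : 0 < p) (hp1 : p < 1)
    (hC : snrThreshold q < (1 - p * q / ((q : ℝ) - 1)) ^ 2 * d) {V W : Fin q → Fin q → ℝ}
    (h : IsGoodPair V W) (m : ℕ) (i : Fin q) (t : (Fin (m + 1) → Fin d) → Fin q) :
    0 < leafChan d p W (m + 1) i t := by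
  rw [leafChan_succ]
  exact (isGoodPair_leafChan hq hp0 hp1 hC h m).step_pos hq hp0 hp1 _ _

lemma affGap_leafChan_le (hq : 3 ≤ q) {p : ℝ} (hp0 : 0 < p) (hp1 : p < 1)
    (hC : snrThreshold q < (1 - p * q / ((q : ℝ) - 1)) ^ 2 * d) {V W : Fin q → Fin q → ℝ}
    (h : IsGoodPair V W) (m : ℕ) :
    affGap (leafChan d p V (m + 1)) (leafChan d p W (m + 1))
      ≤ (1 / 4) ^ m * affGap (leafChan d p V 1) (leafChan d p W 1) := by
  induction m with
  | zero => simp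
  | succ m ih =>
    have hg := isGoodPair_leafChan hq hp0 hp1 hC h (m + 1)
    obtain ⟨K, hK⟩ := hg.degradation
    rw [leafChan_succ p V (m + 1), leafChan_succ p W (m + 1), affGap_comp, pow_succ']
    refine (affGap_step_le hq hp0 hp1 hC hK hg.left hg.right
      (leafChan_succ_pos hq hp0 hp1 hC h m) hg.aff_le).trans ?_
    linarith

/-- Optimal reconstruction through the exact and through the noisy leaf channels have the same
limit. -/
lemma tendsto_totalSuccess_leafChan (hq : 3 ≤ q) {p : ℝ} (hp0 : 0 < p) (hp1 : p < 1)
    (hC : snrThreshold q < (1 - p * q / ((q : ℝ) - 1)) ^ 2 * d) {V W : Fin q → Fin q → ℝ}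
    (h : IsGoodPair V W) :
    Tendsto (fun m => |totalSuccess (leafChan d p V m) - totalSuccess (leafChan d p W m)|)
      atTop (nhds 0) := by
  rw [← tendsto_add_atTop_iff_nat 1]
  set G := affGap (leafChan d p V 1) (leafChan d p W 1)
  have hlim : Tendsto (fun m : ℕ => (1 / 2 : ℝ) ^ m * (2 * G + 4 * q)) atTop (nhds 0) := by
    simpa using (tendsto_pow_atTop_nhds_zero_of_lt_one (r := (1 / 2 : ℝ)) (by norm_num)
      (by norm_num)).mul_const (2 * G + 4 * q)
  refine squeeze_zero (fun m => abs_nonneg _) (fun m => ?_) hlim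
  have hg := isGoodPair_leafChan hq hp0 hp1 hC h (m + 1)
  obtain ⟨K, hK⟩ := hg.degradation
  rw [abs_of_nonneg (sub_nonneg.2 (totalSuccess_le hq hK))]
  have hδ : (0 : ℝ) < (1 / 2) ^ m := by positivity
  refine (totalSuccess_sub_le hq hK hg.left (leafChan_succ_pos hq hp0 hp1 hC h m) hδ).trans ?_
  have h1 := mul_le_mul_of_nonneg_left (affGap_leafChan_le hq hp0 hp1 hC h m)
    (inv_pos.2 hδ).le
  have h2 : ((1 / 2 : ℝ) ^ m)⁻¹ * ((1 / 4) ^ m * G) = (1 / 2) ^ m * G := by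
    rw [show (1 / 4 : ℝ) = 1 / 2 * (1 / 2) by norm_num, mul_pow]
    field_simp
  linarith

end Tree
section Labels

variable {q d : ℕ} {Ω : Type} [MeasurableSpace Ω] {μ : Measure Ω}

lemma integral_comp_fintype {β : Type} [Fintype β] [MeasurableSpace β]
    [MeasurableSingletonClass β] [IsFiniteMeasure μ] {Y : Ω → β} (hY : Measurable Y)
    (H : β → ℝ) : ∫ ω, H (Y ω) ∂μ = ∑ b, μ.real {ω | Y ω = b} * H b := by
  rw [← integral_map hY.aemeasurable (measurable_of_finite H).aestronglyMeasurable,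
    integral_fintype (Integrable.of_finite)]
  refine Finset.sum_congr rfl fun b _ => ?_
  rw [map_measureReal_apply hY (measurableSet_singleton b), smul_eq_mul]
  rfl

/-- Two functions with the same integral on all the fibres of a finite-valued random variable
have the same integral. -/
lemma integral_eq_of_forall_fiber {β : Type} [Fintype β] [MeasurableSpace β]
    [MeasurableSingletonClass β] {X : Ω → β} (hX : Measurable X) {g h : Ω → ℝ}
    (hg : Integrable g μ) (hh : Integrable h μ)
    (H : ∀ ω₀, ∫ ω in {ω | X ω = X ω₀}, g ω ∂μ = ∫ ω in {ω | X ω = X ω₀}, h ω ∂μ) :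
    ∫ ω, g ω ∂μ = ∫ ω, h ω ∂μ := by
  have hU : (⋃ b, X ⁻¹' {b}) = Set.univ := by
    ext ω
    simp
  have hm : ∀ b, MeasurableSet (X ⁻¹' {b}) := fun b => hX (measurableSet_singleton b)
  have hd : Pairwise (Function.onFun Disjoint fun b => X ⁻¹' {b}) := fun a b hab =>
    Disjoint.preimage _ (by simpa using hab)
  rw [← setIntegral_univ, ← setIntegral_univ (f := h), ← hU,
    integral_iUnion_fintype hm hd fun _ => hg.integrableOn,
    integral_iUnion_fintype hm hd fun _ => hh.integrableOn]
  refine Finset.sum_congr rfl fun b _ => ?_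
  by_cases hb : ∃ ω₀, X ω₀ = b
  · obtain ⟨ω₀, rfl⟩ := hb
    exact H ω₀
  · have : X ⁻¹' {b} = ∅ := by
      ext ω
      simpa using fun h => hb ⟨ω, h⟩
    simp [this]

/-- The success probability of the maximum posterior rule. -/
lemma integral_iSup_condExp [IsProbabilityMeasure μ] {β : Type} [Fintype β] [MeasurableSpace β]
    [MeasurableSingletonClass β] {L : Ω → β} (hL : Measurable L) {root : Ω → Fin q}
    (hroot : Measurable root) :
    ∫ ω, ⨆ i, (μ[Set.indicator {ω | root ω = i} (fun _ => (1 : ℝ)) |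
      MeasurableSpace.comap L inferInstance]) ω ∂μ
        = ∑ o, ⨆ i, μ.real {ω | root ω = i ∧ L ω = o} := by
  have hm := hL.comap_le
  have hi : ∀ i, MeasurableSet {ω | root ω = i} := fun i => hroot (measurableSet_singleton i)
  have hfac : ∀ i, ∃ ψ : β → ℝ, (μ[Set.indicator {ω | root ω = i} (fun _ => (1 : ℝ)) |
      MeasurableSpace.comap L inferInstance]) = ψ ∘ L := by
    intro i
    obtain ⟨ψ, -, hψ⟩ := StronglyMeasurable.exists_eq_measurable_comp
      (stronglyMeasurable_condExp (μ := μ) (m := MeasurableSpace.comap L inferInstance)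
        (f := Set.indicator {ω | root ω = i} (fun _ => (1 : ℝ))))
    exact ⟨ψ, hψ⟩
  choose ψ hψ using hfac
  simp only [hψ, Function.comp_apply]
  rw [integral_comp_fintype hL fun o => ⨆ i, ψ i o]
  refine Finset.sum_congr rfl fun o _ => ?_
  rw [Real.mul_iSup_of_nonneg measureReal_nonneg]
  congr 1
  funext i
  have ho : MeasurableSet {ω | L ω = o} := hL (measurableSet_singleton o)
  have h := setIntegral_condExp hm (f := Set.indicator {ω | root ω = i} (fun _ => (1 : ℝ)))
    ((integrable_const (μ := μ) (1 : ℝ)).indicator (hi i))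
    (s := {ω | L ω = o}) ⟨{o}, measurableSet_singleton o, rfl⟩
  rw [hψ, setIntegral_congr_fun (g := fun _ => ψ i o) ho fun ω hω => by
    simp only [Function.comp_apply]; rw [show L ω = o from hω], setIntegral_const,
    setIntegral_indicator (hi i), setIntegral_const] at h
  simp only [smul_eq_mul, mul_one] at h
  rw [h]
  congr 1
  ext ω
  simp [and_comm]

/-- The joint law of the broadcast process `σ` and of its noisy version `τ`. -/
def IsBroadcast (p : ℝ) (Δ : Fin q → Fin q → ℝ) (μ : Measure Ω)
    (σ τ : List (Fin d) → Ω → Fin q) : Prop :=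
  ∀ (k : ℕ) (ℓ t : List (Fin d) → Fin q),
    (μ {ω | ∀ v : List (Fin d), v.length ≤ k → σ v ω = ℓ v ∧ τ v ω = t v}).toReal
      = ((q : ℝ))⁻¹ *
        (∏ j ∈ Finset.range k, ∏ f : Fin j → Fin d, ∏ i : Fin d,
          transM q p (ℓ (List.ofFn f)) (ℓ (i :: List.ofFn f))) *
        ∏ j ∈ Finset.range (k + 1), ∏ f : Fin j → Fin d,
          Δ (ℓ (List.ofFn f)) (t (List.ofFn f))

lemma prod_fin_succ_fun {m : ℕ} {γ : Type} [CommMonoid γ] (F : (Fin (m + 1) → Fin d) → γ) :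
    ∏ g, F g = ∏ f : Fin m → Fin d, ∏ i, F (Fin.cons (α := fun _ => Fin d) i f) := by
  rw [← (Fin.consEquiv fun _ : Fin (m + 1) => Fin d).prod_comp, Fintype.prod_prod_type,
    Finset.prod_comm]
  rfl

/-- The labels and noisy labels of the vertices at depth `m`. -/
def levelLabels (σ τ : List (Fin d) → Ω → Fin q) (m : ℕ) (ω : Ω) (f : Fin m → Fin d) :
    Fin q × Fin q :=
  (σ (List.ofFn f) ω, τ (List.ofFn f) ω)

/-- The event that the labels and noisy labels up to depth `m` are given by `ℓ` and `t`. -/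
def treeCylinder (σ τ : List (Fin d) → Ω → Fin q) (ℓ t : List (Fin d) → Fin q) (m : ℕ) : Set Ω :=
  {ω | ∀ v : List (Fin d), v.length ≤ m → σ v ω = ℓ v ∧ τ v ω = t v}

lemma measurable_levelLabels {σ τ : List (Fin d) → Ω → Fin q} (hσ : ∀ v, Measurable (σ v))
    (hτ : ∀ v, Measurable (τ v)) (m : ℕ) : Measurable (levelLabels σ τ m) :=
  measurable_pi_lambda _ fun _ => (hσ _).prodMk (hτ _)

lemma IsBroadcast.cylinder_succ {p : ℝ} {Δ : Fin q → Fin q → ℝ}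
    {σ τ : List (Fin d) → Ω → Fin q} (h : IsBroadcast p Δ μ σ τ) (ℓ t : List (Fin d) → Fin q)
    (m : ℕ) (a : (Fin (m + 1) → Fin d) → Fin q × Fin q) :
    μ.real ({ω | levelLabels σ τ (m + 1) ω = a} ∩ treeCylinder σ τ ℓ t m)
      = μ.real (treeCylinder σ τ ℓ t m) * ∏ g, (transM q p (ℓ (List.ofFn (Fin.tail g))) (a g).1
          * Δ (a g).1 (a g).2) := by
  set ℓ' := Function.extend List.ofFn (fun g => (a g).1) ℓ
  set t' := Function.extend List.ofFn (fun g => (a g).2) t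
  have hinj : Function.Injective (List.ofFn : (Fin (m + 1) → Fin d) → List (Fin d)) :=
    List.ofFn_injective
  have hex : ∀ v : List (Fin d), v.length ≤ m →
      ¬ ∃ g : Fin (m + 1) → Fin d, List.ofFn g = v := by
    rintro v hv ⟨g, rfl⟩
    simp at hv
  have hℓ1 : ∀ v : List (Fin d), v.length ≤ m → ℓ' v = ℓ v := fun v hv =>
    Function.extend_apply' _ _ _ (hex v hv)
  have ht1 : ∀ v : List (Fin d), v.length ≤ m → t' v = t v := fun v hv =>
    Function.extend_apply' _ _ _ (hex v hv)
  have hℓ2 : ∀ g : Fin (m + 1) → Fin d, ℓ' (List.ofFn g) = (a g).1 := hinj.extend_apply _ _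
  have ht2 : ∀ g : Fin (m + 1) → Fin d, t' (List.ofFn g) = (a g).2 := hinj.extend_apply _ _
  have hset : {ω | levelLabels σ τ (m + 1) ω = a} ∩ treeCylinder σ τ ℓ t m
      = treeCylinder σ τ ℓ' t' (m + 1) := by
    ext ω
    constructor
    · rintro ⟨h1, h2⟩ v hv
      rcases Nat.lt_or_ge m v.length with h3 | h3
      · have h4 : v.length = m + 1 := by omega
        obtain ⟨g, rfl⟩ : ∃ g : Fin (m + 1) → Fin d, List.ofFn g = v := by
          subst_vars
          exact ⟨fun k => v.get (k.cast h4.symm), by rw [← List.ofFn_congr h4, List.ofFn_get]⟩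
        rw [hℓ2, ht2, ← show levelLabels σ τ (m + 1) ω = a from h1]
        exact ⟨rfl, rfl⟩
      · rw [hℓ1 v h3, ht1 v h3]
        exact h2 v h3
    · intro h1
      refine ⟨funext fun g => ?_, fun v hv => ?_⟩
      · have := h1 (List.ofFn g) (by simp)
        rw [hℓ2, ht2] at this
        exact Prod.ext this.1 this.2
      · rw [← hℓ1 v hv, ← ht1 v hv]
        exact h1 v (by omega)
  have e1 := h (m + 1) ℓ' t'
  have e2 := h m ℓ t
  rw [hset, Measure.real, treeCylinder, e1, Measure.real, treeCylinder, e2, Finset.prod_range_succ,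
    Finset.prod_range_succ _ (m + 1), Finset.prod_mul_distrib]
  have p1 : ∏ j ∈ Finset.range m, ∏ f : Fin j → Fin d, ∏ i : Fin d,
        transM q p (ℓ' (List.ofFn f)) (ℓ' (i :: List.ofFn f))
      = ∏ j ∈ Finset.range m, ∏ f : Fin j → Fin d, ∏ i : Fin d,
        transM q p (ℓ (List.ofFn f)) (ℓ (i :: List.ofFn f)) := by
    refine Finset.prod_congr rfl fun j hj => ?_
    have hj := Finset.mem_range.1 hj
    refine Finset.prod_congr rfl fun f _ => Finset.prod_congr rfl fun i _ => ?_
    rw [hℓ1 _ (by simp; omega), hℓ1 _ (by simp; omega)]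
  have p2 : ∏ j ∈ Finset.range (m + 1), ∏ f : Fin j → Fin d,
        Δ (ℓ' (List.ofFn f)) (t' (List.ofFn f))
      = ∏ j ∈ Finset.range (m + 1), ∏ f : Fin j → Fin d,
        Δ (ℓ (List.ofFn f)) (t (List.ofFn f)) := by
    refine Finset.prod_congr rfl fun j hj => ?_
    have hj := Finset.mem_range.1 hj
    refine Finset.prod_congr rfl fun f _ => ?_
    rw [hℓ1 _ (by simp; omega), ht1 _ (by simp; omega)]
  have p3 : ∏ f : Fin m → Fin d, ∏ i : Fin d,
        transM q p (ℓ' (List.ofFn f)) (ℓ' (i :: List.ofFn f))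
      = ∏ g : Fin (m + 1) → Fin d, transM q p (ℓ (List.ofFn (Fin.tail g))) (a g).1 := by
    rw [prod_fin_succ_fun]
    refine Finset.prod_congr rfl fun f _ => Finset.prod_congr rfl fun i _ => ?_
    rw [Fin.tail_cons, hℓ1 _ (by simp), ← hℓ2, List.ofFn_succ]
    simp
  rw [p1, p2, p3]
  simp only [hℓ2, ht2]
  ring

lemma IsBroadcast.setIntegral_cylinder [IsProbabilityMeasure μ] {p : ℝ} {Δ : Fin q → Fin q → ℝ}
    {σ τ : List (Fin d) → Ω → Fin q} (h : IsBroadcast p Δ μ σ τ) (hσ : ∀ v, Measurable (σ v))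
    (hτ : ∀ v, Measurable (τ v)) (ℓ t : List (Fin d) → Fin q) (m : ℕ)
    (φ : (Fin (m + 1) → Fin d) → Fin q × Fin q → ℝ) :
    ∫ ω in treeCylinder σ τ ℓ t m, ∏ g, φ g (levelLabels σ τ (m + 1) ω g) ∂μ
      = μ.real (treeCylinder σ τ ℓ t m) * ∏ f : Fin m → Fin d, ∏ i, mixVec p
        (fun s => ∑ s', Δ s s' * φ (Fin.cons (α := fun _ => Fin d) i f) (s, s'))
          (ℓ (List.ofFn f)) := by
  have hY := measurable_levelLabels hσ hτ (m + 1)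
  rw [integral_comp_fintype hY fun a => ∏ g, φ g (a g)]
  have hstep : ∀ a : (Fin (m + 1) → Fin d) → Fin q × Fin q,
      (μ.restrict (treeCylinder σ τ ℓ t m)).real {ω | levelLabels σ τ (m + 1) ω = a}
          * ∏ g, φ g (a g)
        = μ.real (treeCylinder σ τ ℓ t m) * ∏ g, (transM q p (ℓ (List.ofFn (Fin.tail g))) (a g).1
          * Δ (a g).1 (a g).2 * φ g (a g)) := by
    intro a
    have ha : MeasurableSet {ω | levelLabels σ τ (m + 1) ω = a} := hY (measurableSet_singleton a)
    rw [measureReal_restrict_apply ha, h.cylinder_succ,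
      Finset.prod_mul_distrib (g := fun g => φ g (a g)), mul_assoc]
  simp only [hstep]
  rw [← Finset.mul_sum, ← Fintype.prod_sum fun (g : Fin (m + 1) → Fin d) (y : Fin q × Fin q) =>
    transM q p (ℓ (List.ofFn (Fin.tail g))) y.1 * Δ y.1 y.2 * φ g y, prod_fin_succ_fun]
  congr 1
  refine Finset.prod_congr rfl fun f _ => Finset.prod_congr rfl fun i _ => ?_
  rw [Fintype.sum_prod_type, mixVec]
  simp only [Fin.tail_cons, Finset.mul_sum, mul_assoc]

lemma fiber_eq_treeCylinder {Ω : Type} (σ τ : List (Fin d) → Ω → Fin q) (m : ℕ) (ω₀ : Ω) :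
    {ω | (fun j : Fin (m + 1) => levelLabels σ τ j ω) = fun j : Fin (m + 1) => levelLabels σ τ j ω₀}
      = treeCylinder σ τ (fun v => σ v ω₀) (fun v => τ v ω₀) m := by
  ext ω
  constructor
  · intro h v hv
    have := congrFun (congrFun h ⟨v.length, by omega⟩) v.get
    simp only [levelLabels, List.ofFn_get, Prod.mk.injEq] at this
    exact this
  · intro h
    funext j f
    have := h (List.ofFn f) (by simp; omega)
    exact Prod.ext this.1 this.2

lemma IsBroadcast.integral_succ [IsProbabilityMeasure μ] {p : ℝ} {Δ : Fin q → Fin q → ℝ}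
    {σ τ : List (Fin d) → Ω → Fin q} (h : IsBroadcast p Δ μ σ τ) (hσ : ∀ v, Measurable (σ v))
    (hτ : ∀ v, Measurable (τ v)) (m : ℕ) (φ : (Fin (m + 1) → Fin d) → Fin q × Fin q → ℝ)
    (i : Fin q) :
    ∫ ω in {ω | σ [] ω = i}, ∏ g, φ g (levelLabels σ τ (m + 1) ω g) ∂μ
      = ∫ ω in {ω | σ [] ω = i}, ∏ f : Fin m → Fin d, ∏ c, mixVec p
        (fun s => ∑ s', Δ s s' * φ (Fin.cons (α := fun _ => Fin d) c f) (s, s'))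
          (levelLabels σ τ m ω f).1 ∂μ := by
  have hi : MeasurableSet {ω | σ [] ω = i} := hσ [] (measurableSet_singleton i)
  have hX : Measurable fun ω => fun j : Fin (m + 1) => levelLabels σ τ j ω :=
    measurable_pi_lambda _ fun j => measurable_levelLabels hσ hτ j
  have hint : ∀ (k : ℕ) (H : ((Fin k → Fin d) → Fin q × Fin q) → ℝ),
      Integrable (fun ω => H (levelLabels σ τ k ω)) (μ.restrict {ω | σ [] ω = i}) := by
    intro k H
    exact (Integrable.of_finite (f := H)).comp_measurable (measurable_levelLabels hσ hτ k)
  refine integral_eq_of_forall_fiber hX (hint (m + 1) fun a => ∏ g, φ g (a g))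
    (hint m fun a => ∏ f : Fin m → Fin d, ∏ c, mixVec p
        (fun s => ∑ s', Δ s s' * φ (Fin.cons (α := fun _ => Fin d) c f) (s, s')) (a f).1)
    fun ω₀ => ?_
  have hA : MeasurableSet (treeCylinder σ τ (fun v => σ v ω₀) (fun v => τ v ω₀) m) := by
    rw [← fiber_eq_treeCylinder]
    exact hX (measurableSet_singleton _)
  rw [fiber_eq_treeCylinder, Measure.restrict_restrict hA]
  by_cases h0 : σ [] ω₀ = i
  · have hsub : treeCylinder σ τ (fun v => σ v ω₀) (fun v => τ v ω₀) m ∩ {ω | σ [] ω = i}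
        = treeCylinder σ τ (fun v => σ v ω₀) (fun v => τ v ω₀) m :=
      Set.inter_eq_left.2 fun ω hω => (hω [] (by simp)).1.trans h0
    rw [hsub, h.setIntegral_cylinder hσ hτ, setIntegral_congr_fun hA (g := fun _ =>
      ∏ f : Fin m → Fin d, ∏ c, mixVec p
        (fun s => ∑ s', Δ s s' * φ (Fin.cons (α := fun _ => Fin d) c f) (s, s'))
          (σ (List.ofFn f) ω₀)), setIntegral_const, smul_eq_mul]
    intro ω hω
    refine Finset.prod_congr rfl fun f _ => Finset.prod_congr rfl fun c _ => ?_
    rw [levelLabels, (hω (List.ofFn f) (by simp)).1]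
  · have hemp : treeCylinder σ τ (fun v => σ v ω₀) (fun v => τ v ω₀) m ∩ {ω | σ [] ω = i} = ∅ := by
      ext ω
      simp only [Set.mem_inter_iff, Set.mem_ofPred_eq, Set.mem_empty_iff_false, iff_false]
      rintro ⟨h1, h2⟩
      exact h0 ((h1 [] (by simp)).1.symm.trans h2)
    simp [hemp]

lemma IsBroadcast.integral_zero [IsProbabilityMeasure μ] {p : ℝ} {Δ : Fin q → Fin q → ℝ}
    {σ τ : List (Fin d) → Ω → Fin q} (h : IsBroadcast p Δ μ σ τ) (hσ : ∀ v, Measurable (σ v))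
    (hτ : ∀ v, Measurable (τ v)) (φ : (Fin 0 → Fin d) → Fin q × Fin q → ℝ) (i : Fin q) :
    ∫ ω in {ω | σ [] ω = i}, ∏ f, φ f (levelLabels σ τ 0 ω f) ∂μ
      = (q : ℝ)⁻¹ * ∑ s', Δ i s' * φ Fin.elim0 (i, s') := by
  have hi : MeasurableSet {ω | σ [] ω = i} := hσ [] (measurableSet_singleton i)
  have hφ : ∀ ω, ∏ f, φ f (levelLabels σ τ 0 ω f) = φ Fin.elim0 (σ [] ω, τ [] ω) := by
    intro ω
    rw [Fintype.prod_subsingleton _ Fin.elim0]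
    rfl
  simp only [hφ]
  rw [setIntegral_congr_fun hi (g := fun ω => φ Fin.elim0 (i, τ [] ω)) fun ω hω => by
    simp only; rw [show σ [] ω = i from hω], integral_comp_fintype (hτ [])
      fun s' => φ Fin.elim0 (i, s'), Finset.mul_sum]
  refine Finset.sum_congr rfl fun s' _ => ?_
  have h0 := h 0 (fun _ => i) (fun _ => s')
  simp only [Finset.range_zero, Finset.prod_empty, mul_one, zero_add, Finset.range_one,
    Finset.prod_singleton, Finset.prod_const, Finset.card_univ, Fintype.card_fun,
    Fintype.card_fin, pow_zero, pow_one] at h0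
  have hs : MeasurableSet {ω | τ [] ω = s'} := hτ [] (measurableSet_singleton s')
  rw [measureReal_restrict_apply hs, ← mul_assoc, ← h0,
    Measure.real]
  congr 3
  ext ω
  simp only [Set.mem_inter_iff, Set.mem_ofPred_eq, Nat.le_zero, List.length_eq_zero_iff,
    forall_eq]
  exact and_comm

lemma IsBroadcast.sum_noise [IsProbabilityMeasure μ] (hq : 3 ≤ q) (hd : 1 ≤ d) {p : ℝ}
    (hp0 : 0 < p) (hp1 : p < 1) (hlam : 1 - p * q / ((q : ℝ) - 1) ≠ 0) {Δ : Fin q → Fin q → ℝ}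
    {σ τ : List (Fin d) → Ω → Fin q} (h : IsBroadcast p Δ μ σ τ) (hσ : ∀ v, Measurable (σ v))
    (hτ : ∀ v, Measurable (τ v)) (h0 : ∀ i j, 0 ≤ Δ i j) (hcol : ∀ j, ∑ i, Δ i j = 1)
    (hdiag : ∀ i, 1 - 1 / (q : ℝ) ≤ Δ i i) (i : Fin q) : ∑ j, Δ i j = 1 := by
  have hq' : (3 : ℝ) ≤ q := by exact_mod_cast hq
  have hi : MeasurableSet {ω | σ [] ω = i} := hσ [] (measurableSet_singleton i)
  have e1 := h.integral_succ hσ hτ 0 (fun _ _ => 1) i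
  have e2 := h.integral_zero hσ hτ (fun _ _ => 1) i
  simp only [Finset.prod_const_one, mul_one] at e1 e2
  have hr0 : 0 < ∑ s', Δ i s' := by
    have h1 : 1 / (q : ℝ) ≤ 1 / 3 := one_div_le_one_div_of_le (by norm_num) hq'
    have h2 := Finset.single_le_sum (f := fun s' => Δ i s') (fun s' _ => h0 i s')
      (Finset.mem_univ i)
    have h3 := hdiag i
    linarith
  have e3 : ∫ ω in {ω | σ [] ω = i}, ∏ f : Fin 0 → Fin d, ∏ _c : Fin d,
      mixVec p (fun s => ∑ s', Δ s s') (levelLabels σ τ 0 ω f).1 ∂μ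
        = ∫ _ in {ω | σ [] ω = i}, mixVec p (fun s => ∑ s', Δ s s') i ^ d ∂μ := by
    refine setIntegral_congr_fun hi fun ω hω => ?_
    simp only [levelLabels]
    rw [Fintype.prod_subsingleton _ Fin.elim0]
    simp only [List.ofFn_zero]
    rw [show σ [] ω = i from hω]
    simp
  rw [e3] at e1
  simp only [setIntegral_const, smul_eq_mul, mul_one] at e1 e2
  have hpos : 0 < μ.real {ω | σ [] ω = i} := by rw [e2]; positivity
  have hpow : mixVec p (fun s => ∑ s', Δ s s') i ^ d = 1 := by
    have := mul_left_cancel₀ hpos.ne' ((mul_one _).trans e1)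
    exact this.symm
  have hone : mixVec p (fun s => ∑ s', Δ s s') i = 1 :=
    (pow_eq_one_iff_of_nonneg (mixVec_nonneg hq hp0 hp1
      (fun s => Finset.sum_nonneg fun s' _ => h0 s s') i) (by omega)).1 hpow
  rw [mixVec_eq, Finset.sum_comm] at hone
  simp only [hcol, Finset.sum_const, Finset.card_univ, Fintype.card_fin, nsmul_eq_mul,
    mul_one] at hone
  rw [← lam_eq hq] at hone
  refine mul_left_cancel₀ hlam ?_
  have : p / ((q : ℝ) - 1) * q = p * q / ((q : ℝ) - 1) := by ring
  linarith

lemma IsBroadcast.integral_level [IsProbabilityMeasure μ] {p : ℝ} {Δ : Fin q → Fin q → ℝ}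
    {σ τ : List (Fin d) → Ω → Fin q} (h : IsBroadcast p Δ μ σ τ) (hσ : ∀ v, Measurable (σ v))
    (hτ : ∀ v, Measurable (τ v)) (hrow : ∀ i, ∑ j, Δ i j = 1) (m : ℕ)
    (φ : (Fin m → Fin d) → Fin q × Fin q → ℝ) (i : Fin q) :
    ∫ ω in {ω | σ [] ω = i}, ∏ f, φ f (levelLabels σ τ m ω f) ∂μ
      = (q : ℝ)⁻¹ * rootLik p m (fun f s => ∑ s', Δ s s' * φ f (s, s')) i := by
  induction m with
  | zero => exact h.integral_zero hσ hτ φ i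
  | succ m ih =>
    rw [h.integral_succ hσ hτ, ih fun f y => ∏ c, mixVec p
      (fun s => ∑ s', Δ s s' * φ (Fin.cons (α := fun _ => Fin d) c f) (s, s')) y.1, rootLik]
    simp only [← Finset.sum_mul, hrow, one_mul]

lemma IsBroadcast.measureReal_level [IsProbabilityMeasure μ] {p : ℝ} {Δ : Fin q → Fin q → ℝ}
    {σ τ : List (Fin d) → Ω → Fin q} (h : IsBroadcast p Δ μ σ τ) (hσ : ∀ v, Measurable (σ v))
    (hτ : ∀ v, Measurable (τ v)) (hrow : ∀ i, ∑ j, Δ i j = 1) (m : ℕ)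
    (S : (Fin m → Fin d) → Fin q × Fin q → Prop) [∀ f y, Decidable (S f y)] (i : Fin q) :
    μ.real {ω | σ [] ω = i ∧ ∀ f, S f (levelLabels σ τ m ω f)}
      = (q : ℝ)⁻¹ * rootLik p m (fun f s => ∑ s', Δ s s' * if S f (s, s') then 1 else 0) i := by
  have hS : MeasurableSet {ω | ∀ f, S f (levelLabels σ τ m ω f)} :=
    measurable_levelLabels hσ hτ m
      (Set.toFinite {a : (Fin m → Fin d) → Fin q × Fin q | ∀ f, S f (a f)}).measurableSet
  rw [← h.integral_level hσ hτ hrow m (fun f y => if S f y then 1 else 0)]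
  simp only [Fintype.prod_boole]
  have : (fun ω => if ∀ f, S f (levelLabels σ τ m ω f) then (1 : ℝ) else 0)
      = Set.indicator {ω | ∀ f, S f (levelLabels σ τ m ω f)} fun _ => 1 := by
    ext ω
    simp [Set.indicator_apply]
  rw [this, setIntegral_indicator hS, setIntegral_const, smul_eq_mul, mul_one]
  rfl

lemma optRecon_eq_sum [IsProbabilityMeasure μ] {root : Ω → Fin q}
    {leaves : List (Fin d) → Ω → Fin q} (hroot : Measurable root)
    (hleaves : ∀ v, Measurable (leaves v)) (m : ℕ) :
    optRecon μ root leaves m = ∑ o : (Fin m → Fin d) → Fin q,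
      ⨆ i, μ.real {ω | root ω = i ∧ ∀ f, leaves (List.ofFn f) ω = o f} := by
  have hL : Measurable fun ω => fun f : Fin m → Fin d => leaves (List.ofFn f) ω :=
    measurable_pi_lambda _ fun f => hleaves _
  refine (integral_iSup_condExp hL hroot).trans ?_
  simp only [funext_iff]

lemma IsBroadcast.optRecon_left [IsProbabilityMeasure μ] {p : ℝ} {Δ : Fin q → Fin q → ℝ}
    {σ τ : List (Fin d) → Ω → Fin q} (h : IsBroadcast p Δ μ σ τ) (hσ : ∀ v, Measurable (σ v))
    (hτ : ∀ v, Measurable (τ v)) (hrow : ∀ i, ∑ j, Δ i j = 1) (m : ℕ) :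
    optRecon μ (σ []) σ m = (q : ℝ)⁻¹
      * totalSuccess (leafChan d p (fun i j : Fin q => if i = j then 1 else 0) m) := by
  rw [optRecon_eq_sum (hσ []) hσ, totalSuccess, Finset.mul_sum]
  refine Finset.sum_congr rfl fun o _ => ?_
  rw [Real.mul_iSup_of_nonneg (by positivity)]
  congr 1
  funext i
  refine (h.measureReal_level hσ hτ hrow m (fun f y => y.1 = o f) i).trans ?_
  rw [leafChan]
  congr 2
  funext f s
  by_cases hs : s = o f <;> simp [hs, hrow]

lemma IsBroadcast.optRecon_right [IsProbabilityMeasure μ] {p : ℝ} {Δ : Fin q → Fin q → ℝ}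
    {σ τ : List (Fin d) → Ω → Fin q} (h : IsBroadcast p Δ μ σ τ) (hσ : ∀ v, Measurable (σ v))
    (hτ : ∀ v, Measurable (τ v)) (hrow : ∀ i, ∑ j, Δ i j = 1) (m : ℕ) :
    optRecon μ (σ []) τ m = (q : ℝ)⁻¹ * totalSuccess (leafChan d p Δ m) := by
  rw [optRecon_eq_sum (hσ []) hτ, totalSuccess, Finset.mul_sum]
  refine Finset.sum_congr rfl fun o _ => ?_
  rw [Real.mul_iSup_of_nonneg (by positivity)]
  congr 1
  funext i
  refine (h.measureReal_level hσ hτ hrow m (fun f y => y.2 = o f) i).trans ?_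
  simp [leafChan]

end Labels

/-- **Main Theorem.** For the broadcast process on the rooted `d`-regular
tree with `q ≥ 3` communities, there is a constant `C*(q)` depending only on `q` such that
if `λ²d > C*(q)`, then `lim_{m→∞} |E_m − Ẽ_m| = 0`: the optimal probabilities of
reconstructing the root from the exact and from the noisy depth-`m` labels converge to the
same limit. -/
theorem broadcast_optRecon_same_limit (q : ℕ) (hq : 3 ≤ q) :
    ∃ Cstar : ℝ, 0 < Cstar ∧
      ∀ (d : ℕ), 1 ≤ d →
      ∀ (p : ℝ), 0 < p → p < 1 →
      ∀ (Ω : Type) [MeasurableSpace Ω] (μ : Measure Ω) [IsProbabilityMeasure μ]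
        (σ τ : List (Fin d) → Ω → Fin q),
        (∀ v, Measurable (σ v)) → (∀ v, Measurable (τ v)) →
      ∀ (Δ : Fin q → Fin q → ℝ),
        (∀ i j, 0 ≤ Δ i j ∧ Δ i j ≤ 1) →
        (∀ j, ∑ i : Fin q, Δ i j = 1) →
        (∀ i, 1 - 1 / (q : ℝ) ≤ Δ i i) →
        (∀ (k : ℕ) (ℓ t : List (Fin d) → Fin q),
          (μ {ω | ∀ v : List (Fin d), v.length ≤ k → σ v ω = ℓ v ∧ τ v ω = t v}).toReal
            = ((q : ℝ))⁻¹ *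
              (∏ j ∈ Finset.range k, ∏ f : Fin j → Fin d, ∏ i : Fin d,
                transM q p (ℓ (List.ofFn f)) (ℓ (i :: List.ofFn f))) *
              ∏ j ∈ Finset.range (k + 1), ∏ f : Fin j → Fin d,
                Δ (ℓ (List.ofFn f)) (t (List.ofFn f))) →
      ∀ (lam : ℝ), lam = 1 - p * q / ((q : ℝ) - 1) →
        lam ^ 2 * d > Cstar →
        Filter.Tendsto
          (fun m : ℕ => |optRecon μ (σ []) σ m - optRecon μ (σ []) τ m|)
          Filter.atTop (nhds 0) := by
  have hq' : (3 : ℝ) ≤ q := by exact_mod_cast hq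
  have hC0 : 0 < snrThreshold q := by unfold snrThreshold; positivity
  refine ⟨snrThreshold q, hC0, ?_⟩
  intro d hd p hp0 hp1 Ω _ μ _ σ τ hσ hτ Δ hΔ hcol hdiag law lam hlam hC
  subst hlam
  have hlam0 : 1 - p * q / ((q : ℝ) - 1) ≠ 0 := by
    intro h0
    rw [h0] at hC
    norm_num at hC
    linarith
  have h : IsBroadcast p Δ μ σ τ := law
  have hrow := h.sum_noise hq hd hp0 hp1 hlam0 hσ hτ (fun i j => (hΔ i j).1) hcol hdiag
  have hlim := (tendsto_totalSuccess_leafChan hq hp0 hp1 hC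
    (isGoodPair_one hq (fun i j => (hΔ i j).1) hcol hrow hdiag)).const_mul (q : ℝ)⁻¹
  rw [mul_zero] at hlim
  refine hlim.congr fun m => ?_
  rw [h.optRecon_left hσ hτ hrow, h.optRecon_right hσ hτ hrow, ← mul_sub, abs_mul,
    abs_of_nonneg (by positivity : (0 : ℝ) ≤ (q : ℝ)⁻¹)]
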